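/- arXiv:2306.11467 — 2 statements merged into one kernel-verified Lean document; each statement's English description precedes it below -/
import Mathlib

section
/- Let P be a frame polyomino. Then the Krull dimension of K[P] equals |V(P)| − rank(P), the number of vertices of P minus the number of cells of P. -/
noncomputable section

open scoped BigOperators

/-! ## Polyominoes -/

/-- Two cells of `ℤ²` (identified with their lower left corners) share an edge. -/
def cellAdj (c d : ℤ × ℤ) : Prop :=
  (c.1 = d.1 ∧ (d.2 = c.2 + 1 ∨ c.2 = d.2 + 1)) ∨
  (c.2 = d.2 ∧ (d.1 = c.1 + 1 ∨ c.1 = d.1 + 1))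

/-- A polyomino: a nonempty finite collection of cells of `ℤ²` any two of which are
connected by a path of cells of the collection in which consecutive cells share an edge. -/
structure Polyomino : Type where
  cells : Finset (ℤ × ℤ)
  nonempty : cells.Nonempty
  connected : ∀ c ∈ cells, ∀ d ∈ cells,
    Relation.ReflTransGen (fun u v => u ∈ cells ∧ v ∈ cells ∧ cellAdj u v) c d

/-- The four vertices of the cell with lower left corner `c`. -/
def cellVertices (c : ℤ × ℤ) : Finset (ℤ × ℤ) :=
  {c, (c.1 + 1, c.2), (c.1, c.2 + 1), (c.1 + 1, c.2 + 1)}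

/-- The vertex set `V(P)` of a polyomino. -/
def Polyomino.vertexSet (P : Polyomino) : Finset (ℤ × ℤ) :=
  P.cells.biUnion cellVertices

/-- The rank of `P`: the number of its cells. -/
def Polyomino.rank (P : Polyomino) : ℕ := P.cells.card

/-- The cell with lower left corner `c` is contained in the interval `[a, b]` of `ℤ²`. -/
def cellInInterval (a b c : ℤ × ℤ) : Prop :=
  a.1 ≤ c.1 ∧ c.1 + 1 ≤ b.1 ∧ a.2 ≤ c.2 ∧ c.2 + 1 ≤ b.2

/-- `[a, b]` is an inner interval of the polyomino `P`: it is a proper interval all of whose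
cells belong to `P`. -/
def IsInnerInterval (P : Polyomino) (a b : ℤ × ℤ) : Prop :=
  a.1 < b.1 ∧ a.2 < b.2 ∧ ∀ c : ℤ × ℤ, cellInInterval a b c → c ∈ P.cells

/-! ## North-east paths, parallelogram and frame polyominoes -/

/-- A north-east path: consecutive points form east or north steps. -/
def IsNEPath (L : List (ℤ × ℤ)) : Prop :=
  L ≠ [] ∧ L.Chain' (fun u v => v = (u.1 + 1, u.2) ∨ v = (u.1, u.2 + 1))

/-- The path `L` contains the east step from `(x, h)` to `(x + 1, h)`. -/
def eastStepOf (L : List (ℤ × ℤ)) (x h : ℤ) : Prop :=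
  ((x, h), (x + 1, h)) ∈ L.zip L.tail

/-- The cell with lower left corner `c` lies (strictly) below the north-east path `L`. -/
def cellBelowPath (L : List (ℤ × ℤ)) (c : ℤ × ℤ) : Prop :=
  ∃ h, eastStepOf L c.1 h ∧ c.2 < h

/-- The cell with lower left corner `c` lies (weakly) above the north-east path `L`. -/
def cellAbovePath (L : List (ℤ × ℤ)) (c : ℤ × ℤ) : Prop :=
  ∃ h, eastStepOf L c.1 h ∧ h ≤ c.2

/-- The interior points of a path (all points except the two endpoints). -/
def interiorPts (L : List (ℤ × ℤ)) : List (ℤ × ℤ) := (L.drop 1).dropLast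

/-- `S1` lies above `S2`. -/
def LiesAbove (S1 S2 : List (ℤ × ℤ)) : Prop :=
  ∀ p ∈ interiorPts S1, ∀ q ∈ interiorPts S2, p.1 = q.1 → q.2 < p.2

/-- The combinatorial data of a pair of north-east paths with the same endpoints,
the first lying above the second. -/
structure ParallelogramOn (S1 S2 : List (ℤ × ℤ)) : Prop where
  ne1 : IsNEPath S1
  ne2 : IsNEPath S2
  headEq : S1.head? = S2.head?
  lastEq : S1.getLast? = S2.getLast?
  above : LiesAbove S1 S2

/-- The cells of the region bounded above by `S1` and below by `S2`. -/
def parCells (S1 S2 : List (ℤ × ℤ)) : Set (ℤ × ℤ) :=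
  {c | cellBelowPath S1 c ∧ cellAbovePath S2 c}

/-- `P` is a parallelogram polyomino. -/
def IsParallelogram (P : Polyomino) : Prop :=
  ∃ S1 S2 : List (ℤ × ℤ), ParallelogramOn S1 S2 ∧
    (↑P.cells : Set (ℤ × ℤ)) = parCells S1 S2

/-- The data defining a frame polyomino: a rectangle `[(1,1),(m,n)]` and a parallelogram
polyomino determined by `S1, S2` with endpoints `(a0, b0)` and `(ak, bk)`. -/
structure FrameData : Type where
  m : ℤ
  n : ℤ
  S1 : List (ℤ × ℤ)
  S2 : List (ℤ × ℤ)
  a0 : ℤ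
  b0 : ℤ
  ak : ℤ
  bk : ℤ
  par : ParallelogramOn S1 S2
  head1 : S1.head? = some (a0, b0)
  last1 : S1.getLast? = some (ak, bk)
  ha0 : 1 < a0
  hak : a0 < ak
  ham : ak < m
  hb0 : 1 < b0
  hbk : b0 < bk
  hbn : bk < n

/-- The cells of the hole of a frame polyomino. -/
def FrameData.holeCells (D : FrameData) : Set (ℤ × ℤ) := parCells D.S1 D.S2

/-- The cells of the ambient rectangle `[(1,1),(m,n)]`. -/
def FrameData.rectCells (D : FrameData) : Set (ℤ × ℤ) :=
  {c | 1 ≤ c.1 ∧ c.1 + 1 ≤ D.m ∧ 1 ≤ c.2 ∧ c.2 + 1 ≤ D.n}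

/-- `P` is the frame polyomino determined by the data `D`. -/
def IsFrame (P : Polyomino) (D : FrameData) : Prop :=
  (↑P.cells : Set (ℤ × ℤ)) = D.rectCells \ D.holeCells

/-! ## The polyomino ideal -/

/-- The order on the variables: `x_(i,j) > x_(k,l)` iff `j > l`, or `j = l` and `i > k`.
`varlt u v` says that the variable `x_u` is smaller than `x_v`. -/
def varlt (u v : ℤ × ℤ) : Prop := u.2 < v.2 ∨ (u.2 = v.2 ∧ u.1 < v.1)

/-- The vertices of `P`, as a type. -/
abbrev PVertex (P : Polyomino) : Type := {v : ℤ × ℤ // v ∈ P.vertexSet}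

/-- The polynomial ring `S_P = K[x_v : v ∈ V(P)]`. -/
abbrev PolyRing (K : Type) [Field K] (P : Polyomino) : Type := MvPolynomial (PVertex P) K

/-- The set of inner 2-minors of `P`. -/
def innerMinors (K : Type) [Field K] (P : Polyomino) : Set (PolyRing K P) :=
  { f | ∃ a b c d : PVertex P,
      IsInnerInterval P a.1 b.1 ∧ c.1 = (a.1.1, b.1.2) ∧ d.1 = (b.1.1, a.1.2) ∧
      f = MvPolynomial.X a * MvPolynomial.X b - MvPolynomial.X c * MvPolynomial.X d }

/-- The polyomino ideal `I_P`. -/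
def polyIdeal (K : Type) [Field K] (P : Polyomino) : Ideal (PolyRing K P) :=
  Ideal.span (innerMinors K P)

/-- The coordinate ring `K[P] = S_P / I_P`. -/
abbrev CoordRing (K : Type) [Field K] (P : Polyomino) : Type :=
  PolyRing K P ⧸ polyIdeal K P

/-! ## Monomial orders, initial ideals and Gröbner bases -/

/-- The (degree) reverse lexicographic order on monomials induced by the
variable order `vlt`: first compare total degrees; for equal total degrees,
`m₁ < m₂` iff the smallest variable whose exponents differ has a larger exponent in `m₁`. -/
def revlexLT {α : Type} (vlt : α → α → Prop) (m₁ m₂ : α →₀ ℕ) : Prop :=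
  (m₁.sum fun _ e => e) < (m₂.sum fun _ e => e) ∨
  ((m₁.sum fun _ e => e) = (m₂.sum fun _ e => e) ∧
    ∃ v, m₂ v < m₁ v ∧ ∀ w, vlt w v → m₁ w = m₂ w)

/-- The monomial order `<` on `S_P`. -/
def pmonLT (P : Polyomino) : (PVertex P →₀ ℕ) → (PVertex P →₀ ℕ) → Prop :=
  revlexLT fun u v => varlt u.1 v.1

/-- `m` is the leading monomial of `f` with respect to the monomial order `lt`. -/
def IsLeadMon {α K : Type} [CommSemiring K] (lt : (α →₀ ℕ) → (α →₀ ℕ) → Prop)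
    (f : MvPolynomial α K) (m : α →₀ ℕ) : Prop :=
  m ∈ f.support ∧ ∀ m' ∈ f.support, m' ≠ m → lt m' m

/-- The initial ideal of `I` with respect to the monomial order `lt`: the ideal generated by
the leading monomials of the nonzero elements of `I`. -/
def initialIdeal {α K : Type} [CommSemiring K] (lt : (α →₀ ℕ) → (α →₀ ℕ) → Prop)
    (I : Ideal (MvPolynomial α K)) : Ideal (MvPolynomial α K) :=
  Ideal.span { g | ∃ f ∈ I, f ≠ 0 ∧ ∃ m, IsLeadMon lt f m ∧ g = MvPolynomial.monomial m 1 }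

/-- The initial ideal `in_<(I_P)`. -/
def inIdeal (K : Type) [Field K] (P : Polyomino) : Ideal (PolyRing K P) :=
  initialIdeal (pmonLT P) (polyIdeal K P)

/-- `G` is a Gröbner basis of `I` with respect to `lt`. -/
def IsGroebnerBasis {α K : Type} [CommSemiring K] (lt : (α →₀ ℕ) → (α →₀ ℕ) → Prop)
    (G : Set (MvPolynomial α K)) (I : Ideal (MvPolynomial α K)) : Prop :=
  G ⊆ (I : Set (MvPolynomial α K)) ∧
  initialIdeal lt I =
    Ideal.span { g | ∃ f ∈ G, ∃ m, IsLeadMon lt f m ∧ g = MvPolynomial.monomial m 1 }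

/-- `G` is the reduced Gröbner basis of `I` with respect to `lt`: it is a Gröbner basis,
each element is monic, and no monomial occurring in an element of `G` is divisible by the
leading monomial of a different element of `G`. -/
def IsReducedGroebnerBasis {α K : Type} [CommSemiring K] (lt : (α →₀ ℕ) → (α →₀ ℕ) → Prop)
    (G : Set (MvPolynomial α K)) (I : Ideal (MvPolynomial α K)) : Prop :=
  IsGroebnerBasis lt G I ∧
  (∀ f ∈ G, ∃ m, IsLeadMon lt f m ∧ MvPolynomial.coeff m f = 1) ∧
  (∀ f ∈ G, ∀ m ∈ (f : MvPolynomial α K).support, ∀ f' ∈ G, f' ≠ f →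
    ∀ m', IsLeadMon lt f' m' → ¬ m' ≤ m)

/-! ## The simplicial complex Δ(P) -/

/-- The squarefree exponent vector supported on `W ∩ V(P)`. -/
def expOf (P : Polyomino) (W : Finset (ℤ × ℤ)) : PVertex P →₀ ℕ :=
  ∑ v ∈ P.vertexSet.attach, if v.1 ∈ W then Finsupp.single v 1 else 0

/-- `W` is a face of the simplicial complex `Δ(P)` whose Stanley–Reisner ideal is
`in_<(I_P)`: `W ⊆ V(P)` and the product of the variables indexed by `W` is not in
`in_<(I_P)`. -/
def IsFace (K : Type) [Field K] (P : Polyomino) (W : Finset (ℤ × ℤ)) : Prop :=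
  (↑W : Set (ℤ × ℤ)) ⊆ (↑P.vertexSet : Set (ℤ × ℤ)) ∧
  MvPolynomial.monomial (expOf P W) (1 : K) ∉ inIdeal K P

/-- `W` is a facet (maximal face) of `Δ(P)`. -/
def IsFacet (K : Type) [Field K] (P : Polyomino) (W : Finset (ℤ × ℤ)) : Prop :=
  IsFace K P W ∧ ∀ W' : Finset (ℤ × ℤ), IsFace K P W' → W ⊆ W' → W = W'

/-- `{p, q, r}` is a step of the face `W`, with lower right corner `q`. -/
def IsStep (P : Polyomino) (W : Finset (ℤ × ℤ)) (p q r : ℤ × ℤ) : Prop :=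
  p ∈ W ∧ q ∈ W ∧ r ∈ W ∧
  p.2 = q.2 ∧ q.1 = r.1 ∧ p.1 < q.1 ∧ q.2 < r.2 ∧
  (∀ w ∈ W, w.2 = p.2 → p.1 < w.1 → w.1 < q.1 → False) ∧
  (∀ w ∈ W, w.1 = q.1 → q.2 < w.2 → w.2 < r.2 → False) ∧
  (q.1 - 1, q.2) ∈ P.cells

/-- The number of steps of a face `W`. -/
def stepCount (P : Polyomino) (W : Finset (ℤ × ℤ)) : ℕ :=
  Set.ncard { t : (ℤ × ℤ) × (ℤ × ℤ) × (ℤ × ℤ) | IsStep P W t.1 t.2.1 t.2.2 }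

/-- The simplicial complex generated by a collection of subsets. -/
def genComplex (F : Set (Finset (ℤ × ℤ))) : Set (Finset (ℤ × ℤ)) :=
  { W | ∃ G ∈ F, W ⊆ G }

/-- The lexicographic order on facets: `flexLT F G` iff, listing the elements of `F` and `G`
in decreasing order with respect to the total order on `V(P)`, at the first position where
the lists differ the element of `F` is greater.  Equivalently, the largest element of the
symmetric difference belongs to `F`. -/
def flexLT (F G : Finset (ℤ × ℤ)) : Prop :=
  ∃ v, v ∈ F ∧ v ∉ G ∧ ∀ w, varlt v w → (w ∈ F ↔ w ∈ G)

/-- The facet `F₀` of `Δ(P)`. -/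
def FrameData.F0 (D : FrameData) : Finset (ℤ × ℤ) :=
  Finset.Icc ((1 : ℤ), (1 : ℤ)) (1, D.n) ∪ Finset.Icc ((1 : ℤ), D.n) (D.m, D.n) ∪
    (D.S2.toFinset \ {(D.a0, D.b0), (D.ak, D.bk)})

/-! ## Edge intervals -/

/-- The horizontal unit edge from `(x, y)` to `(x + 1, y)` is an edge of a cell of `P`. -/
def hEdge (P : Polyomino) (x y : ℤ) : Prop :=
  (x, y) ∈ P.cells ∨ (x, y - 1) ∈ P.cells

/-- The vertical unit edge from `(x, y)` to `(x, y + 1)` is an edge of a cell of `P`. -/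
def vEdge (P : Polyomino) (x y : ℤ) : Prop :=
  (x, y) ∈ P.cells ∨ (x - 1, y) ∈ P.cells

/-- `[(i, j), (k, j)]` is a maximal horizontal edge interval of `P`. -/
def IsMaxHEdgeInterval (P : Polyomino) (i k j : ℤ) : Prop :=
  i < k ∧ (∀ l, i ≤ l → l < k → hEdge P l j) ∧ ¬ hEdge P (i - 1) j ∧ ¬ hEdge P k j

/-- `[(x, j), (x, l)]` is a maximal vertical edge interval of `P`. -/
def IsMaxVEdgeInterval (P : Polyomino) (x j l : ℤ) : Prop :=
  j < l ∧ (∀ y, j ≤ y → y < l → vEdge P x y) ∧ ¬ vEdge P x (j - 1) ∧ ¬ vEdge P x l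

/-- The vertex set of the collection of cells of `P` contained in the interval `[a, b]`. -/
def boxVertexSet (P : Polyomino) (a b : ℤ × ℤ) : Set (ℤ × ℤ) :=
  { v | ∃ c ∈ P.cells, cellInInterval a b c ∧ v ∈ cellVertices c }

/-! ## Rook configurations -/

/-- Two (distinct) cells of `P` are in attacking position: they belong to the same row or
the same column of cells of `P`. -/
def attacking (P : Polyomino) (c d : ℤ × ℤ) : Prop :=
  c ≠ d ∧
  ((c.2 = d.2 ∧ ∀ x, min c.1 d.1 ≤ x → x ≤ max c.1 d.1 → (x, c.2) ∈ P.cells) ∨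
   (c.1 = d.1 ∧ ∀ y, min c.2 d.2 ≤ y → y ≤ max c.2 d.2 → (c.1, y) ∈ P.cells))

/-- `R` is a configuration of pairwise non-attacking rooks placed on cells of `P`. -/
def IsRookConfig (P : Polyomino) (R : Finset (ℤ × ℤ)) : Prop :=
  (↑R : Set (ℤ × ℤ)) ⊆ (↑P.cells : Set (ℤ × ℤ)) ∧ ∀ c ∈ R, ∀ d ∈ R, ¬ attacking P c d

/-- Two cells are the diagonal cells of an inner interval of `P`. -/
def diagPair (P : Polyomino) (c d : ℤ × ℤ) : Prop :=
  ∃ a b : ℤ × ℤ, IsInnerInterval P a b ∧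
    ((c = a ∧ d = (b.1 - 1, b.2 - 1)) ∨ (d = a ∧ c = (b.1 - 1, b.2 - 1)))

/-- Two cells are the anti-diagonal cells of an inner interval of `P`. -/
def antiDiagPair (P : Polyomino) (c d : ℤ × ℤ) : Prop :=
  ∃ a b : ℤ × ℤ, IsInnerInterval P a b ∧
    ((c = (a.1, b.2 - 1) ∧ d = (b.1 - 1, a.2)) ∨ (d = (a.1, b.2 - 1) ∧ c = (b.1 - 1, a.2)))

/-- One switch: replace two rooks placed on the diagonal cells of an inner interval by rooks
on its anti-diagonal cells, or vice versa. -/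
def switchStep (P : Polyomino) (R R' : Finset (ℤ × ℤ)) : Prop :=
  ∃ a b : ℤ × ℤ, IsInnerInterval P a b ∧
    ((a ∈ R ∧ (b.1 - 1, b.2 - 1) ∈ R ∧
      R' = insert (a.1, b.2 - 1) (insert (b.1 - 1, a.2)
        ((R.erase a).erase (b.1 - 1, b.2 - 1)))) ∨
     ((a.1, b.2 - 1) ∈ R ∧ (b.1 - 1, a.2) ∈ R ∧
      R' = insert a (insert (b.1 - 1, b.2 - 1)
        ((R.erase (a.1, b.2 - 1)).erase (b.1 - 1, a.2)))))

/-- A canonical configuration: no two rooks are in anti-diagonal position. -/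
def IsCanonical (P : Polyomino) (R : Finset (ℤ × ℤ)) : Prop :=
  ∀ c ∈ R, ∀ d ∈ R, ¬ antiDiagPair P c d

/-- The `k`-rook configurations of `P`, as a type. -/
def RookConfigType (P : Polyomino) (k : ℕ) : Type :=
  { R : Finset (ℤ × ℤ) // IsRookConfig P R ∧ R.card = k }

/-- `r̃_k`: the number of equivalence classes of `k`-rook configurations of `P` under the
equivalence generated by switches. -/
def rtil (P : Polyomino) (k : ℕ) : ℕ :=
  Nat.card (Quot fun R S : RookConfigType P k => switchStep P R.1 S.1)

/-- The rook number of `P`: the maximum number of pairwise non-attacking rooks in `P`. -/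
def rookNumber (P : Polyomino) : ℕ :=
  sSup { k | ∃ R : Finset (ℤ × ℤ), IsRookConfig P R ∧ R.card = k }

/-! ## Hilbert functions -/

/-- The Hilbert function of the standard graded algebra `K[P]`. -/
def hilbertFunction (K : Type) [Field K] (P : Polyomino) (k : ℕ) : ℕ :=
  Module.finrank K
    (Submodule.map (Ideal.Quotient.mkₐ K (polyIdeal K P)).toLinearMap
      (MvPolynomial.homogeneousSubmodule (PVertex P) K k))

/-- The Hilbert–Poincaré series of `K[P]`, as a power series over `ℤ`. -/
def hilbertSeries (K : Type) [Field K] (P : Polyomino) : PowerSeries ℤ :=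
  PowerSeries.mk fun k => (hilbertFunction K P k : ℤ)

set_option synthInstance.maxHeartbeats 1000000 in
/-- `K[P]` is Cohen–Macaulay: there exists a regular sequence, consisting of elements of the
irrelevant maximal ideal, whose length equals the Krull dimension of `K[P]`. -/
def IsCMCoordRing (K : Type) [Field K] (P : Polyomino) : Prop :=
  ∃ rs : List (CoordRing K P),
    RingTheory.Sequence.IsRegular (CoordRing K P) rs ∧
    (∀ r ∈ rs, r ∈ Ideal.map (Ideal.Quotient.mk (polyIdeal K P))
      (Ideal.span (Set.range (MvPolynomial.X : PVertex P → PolyRing K P)))) ∧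
    (rs.length : WithBot (WithTop ℕ)) = ringKrullDim (CoordRing K P)

/-! ## Maximal chains and descents (for parallelogram polyominoes) -/

/-- `C` is a maximal chain of the poset `V(P)` (with the componentwise order). -/
def IsMaximalChainOn (P : Polyomino) (C : Finset (ℤ × ℤ)) : Prop :=
  (↑C : Set (ℤ × ℤ)) ⊆ (↑P.vertexSet : Set (ℤ × ℤ)) ∧
  IsChain (· ≤ ·) (↑C : Set (ℤ × ℤ)) ∧
  ∀ C' : Finset (ℤ × ℤ), (↑C' : Set (ℤ × ℤ)) ⊆ (↑P.vertexSet : Set (ℤ × ℤ)) →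
    IsChain (· ≤ ·) (↑C' : Set (ℤ × ℤ)) → C ⊆ C' → C = C'

/-- The chain `C` has a descent at the cell of `P` with lower left corner `c`. -/
def descentAt (P : Polyomino) (C : Finset (ℤ × ℤ)) (c : ℤ × ℤ) : Prop :=
  c ∈ P.cells ∧ c ∈ C ∧ (c.1 + 1, c.2) ∈ C ∧ (c.1 + 1, c.2 + 1) ∈ C

/-- The number of descents of the chain `C`. -/
def descentCount (P : Polyomino) (C : Finset (ℤ × ℤ)) : ℕ :=
  Set.ncard { c : ℤ × ℤ | descentAt P C c }

/-! ## Minimal graded free resolutions and Castelnuovo–Mumford regularity -/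

/-- A finite minimal graded free resolution of `S_P / I` over `S_P`:
`F_d = ⊕_{i} S_P(-tw d i)` with `F_0 = S_P`, differentials given by matrices of homogeneous
polynomials of the appropriate degrees with entries in the irrelevant maximal ideal,
exact away from homological degree `0` and with image `I` in homological degree `0`. -/
structure MinimalGradedFreeResolution (K : Type) [Field K] (P : Polyomino)
    (I : Ideal (PolyRing K P)) : Type where
  len : ℕ
  t : ℕ → ℕ
  tw : (d : ℕ) → Fin (t d) → ℤ
  mat : (d : ℕ) → Matrix (Fin (t d)) (Fin (t (d + 1))) (PolyRing K P)
  t0 : t 0 = 1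
  tw0 : ∀ i, tw 0 i = 0
  finite : ∀ d, len < d → t d = 0
  graded : ∀ d i j, mat d i j = 0 ∨
    ∃ e : ℕ, (e : ℤ) = tw (d + 1) j - tw d i ∧ (mat d i j).IsHomogeneous e
  minimal : ∀ d i j, MvPolynomial.coeff 0 (mat d i j) = 0
  aug : LinearMap.range (mat 0).mulVecLin =
    Submodule.pi Set.univ (fun _ : Fin (t 0) => I)
  isexact : ∀ d, LinearMap.range (mat (d + 1)).mulVecLin = LinearMap.ker (mat d).mulVecLin

end



open Algebra in
theorem kd_trdeg_lt {K A B : Type} [Field K] [CommRing A] [IsDomain A] [CommRing B] [IsDomain B]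
    [Algebra K A] [Algebra K B] (f : A →ₐ[K] B) (hf : Function.Surjective f)
    (z : A) (hz : z ≠ 0) (hfz : f z = 0) : Algebra.trdeg K B + 1 ≤ Algebra.trdeg K A := by
  obtain ⟨s, hs⟩ := exists_isTranscendenceBasis K B
  choose g hg using fun b : s => hf b.1
  have hind : AlgebraicIndependent K (f ∘ g) := by
    have : f ∘ g = ((↑) : s → B) := funext hg
    rw [this]; exact hs.1
  have hg' : AlgebraicIndependent K g := hind.of_comp f
  have htr : Transcendental (adjoin K (Set.range g)) z := by
    intro halg
    obtain ⟨r, hr, hdvd⟩ := halg.exists_nonzero_dvd (mem_nonZeroDivisors_of_ne_zero hz)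
    apply hr
    have h0 : f (r : A) = 0 := by
      obtain ⟨c, hc⟩ := hdvd
      have : (r : A) = z * c := hc
      rw [this, map_mul, hfz, zero_mul]
    have hmem : (r : A) ∈ (MvPolynomial.aeval (R := K) g).range :=
      (Algebra.adjoin_range_eq_range_aeval K g) ▸ r.2
    obtain ⟨p, hp⟩ := hmem
    have hp' : MvPolynomial.aeval g p = (r : A) := hp
    have : MvPolynomial.aeval (f ∘ g) p = 0 := by
      have he : MvPolynomial.aeval (f ∘ g) = f.comp (MvPolynomial.aeval (R := K) g) := by
        ext; simp
      rw [he, AlgHom.comp_apply, hp', h0]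
    have hp0 : p = 0 := hind (by rw [this, map_zero])
    ext
    rw [← hp', hp0]; simp
  have := (hg'.option_iff_transcendental z).mpr htr
  have h2 := this.cardinalMk_le_trdeg
  rw [Cardinal.mk_option] at h2
  rwa [hs.cardinalMk_eq_trdeg] at h2

open Algebra in
theorem kd_trdeg_le {K σ A : Type} [Field K] [Fintype σ] [CommRing A] [IsDomain A] [Algebra K A]
    (I : Ideal (MvPolynomial σ K)) (d : ℕ)
    (lt : σ → σ → Prop) (wf : WellFounded lt)
    (bound : ∀ W : Finset σ, (∀ c ∈ W, ∀ e ∈ W, ¬ ∃ a b, lt a c ∧ lt b c ∧ lt e c ∧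
      (MvPolynomial.X c * MvPolynomial.X e - MvPolynomial.X a * MvPolynomial.X b :
        MvPolynomial σ K) ∈ I) → W.card ≤ d)
    (φ : MvPolynomial σ K →ₐ[K] A) (hφ : Function.Surjective φ) (hφI : ∀ q ∈ I, φ q = 0) :
    Algebra.trdeg K A ≤ d := by
  classical
  let x : σ → A := fun v => φ (MvPolynomial.X v)
  let W : Finset σ := Finset.univ.filter
    fun v => ¬ IsAlgebraic (adjoin K (x '' {u | lt u v})) (x v)
  have hW : W.card ≤ d := by
    apply bound
    rintro c hc e he ⟨a, b, hac, hbc, hec, hI⟩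
    simp only [W, Finset.mem_filter, Finset.mem_univ, true_and] at hc he
    apply hc
    have hxe : x e ≠ 0 := by
      intro h0; apply he; rw [h0]; exact isAlgebraic_zero
    have hrel : x c * x e = x a * x b := by
      have := hφI _ hI
      rw [map_sub, map_mul, map_mul, sub_eq_zero] at this
      exact this
    let S := adjoin K (x '' {u | lt u c})
    have hm : ∀ u, lt u c → x u ∈ S := fun u hu => subset_adjoin ⟨u, hu, rfl⟩
    let xe : S := ⟨x e, hm e hec⟩
    let xa : S := ⟨x a, hm a hac⟩
    let xb : S := ⟨x b, hm b hbc⟩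
    refine ⟨Polynomial.C xe * Polynomial.X - Polynomial.C (xa * xb), ?_, ?_⟩
    · intro h0
      have := congrArg (fun q => Polynomial.coeff q 1) h0
      simp [Polynomial.coeff_C] at this
      exact hxe (congrArg Subtype.val this)
    · simp only [map_sub, map_mul, Polynomial.aeval_C, Polynomial.aeval_X]
      change x e * x c - x a * x b = 0
      rw [mul_comm, hrel, sub_self]
  have hall : ∀ v, IsAlgebraic (adjoin K (x '' (W : Set σ))) (x v) := by
    intro v
    induction v using wf.induction with
    | _ v ih =>
      by_cases hv : v ∈ W
      · exact isAlgebraic_algebraMap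
          (⟨x v, subset_adjoin ⟨v, hv, rfl⟩⟩ : adjoin K (x '' (W : Set σ)))
      · simp only [W, Finset.mem_filter, Finset.mem_univ, true_and, not_not] at hv
        refine hv.adjoin_of_forall_isAlgebraic ?_
        rintro y ⟨⟨u, hu, rfl⟩, -⟩
        exact ih u hu
  have halg : Algebra.IsAlgebraic (adjoin K (x '' (W : Set σ))) A := by
    constructor
    intro y
    have hy : IsAlgebraic (adjoin K (Set.range x)) y := by
      have htop : y ∈ adjoin K (Set.range x) := by
        obtain ⟨q, rfl⟩ := hφ y
        rw [Algebra.adjoin_range_eq_range_aeval]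
        refine ⟨q, ?_⟩
        have : MvPolynomial.aeval x = φ := by ext; simp [x]
        rw [← this]; rfl
      exact isAlgebraic_algebraMap (⟨y, htop⟩ : adjoin K (Set.range x))
    refine hy.adjoin_of_forall_isAlgebraic ?_
    rintro y ⟨⟨u, rfl⟩, -⟩
    exact hall u
  have h1 := Algebra.IsAlgebraic.trdeg_le_cardinalMk K (x '' (W : Set σ)) (A := A)
  refine h1.trans (Cardinal.mk_image_le.trans ?_)
  simp only [Finset.coe_sort_coe, Cardinal.mk_coe_finset]
  exact_mod_cast hW

theorem kd_krullDim_le {K R : Type} [Field K] [CommRing R] [Algebra K R] (d : ℕ)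
    (key : ∀ p : Ideal R, p.IsPrime → Algebra.trdeg K (R ⧸ p) ≤ d) : ringKrullDim R ≤ d := by
  have keyfin : ∀ p : PrimeSpectrum R, ∃ t : ℕ, Algebra.trdeg K (R ⧸ p.asIdeal) = t ∧ t ≤ d := by
    intro p
    obtain ⟨t, ht⟩ := Cardinal.lt_aleph0.mp ((key p.asIdeal p.2).trans_lt (Cardinal.natCast_lt_aleph0))
    refine ⟨t, ht, ?_⟩
    have := key p.asIdeal p.2
    rw [ht] at this
    exact_mod_cast this
  choose t ht htd using keyfin
  have hanti : ∀ p q : PrimeSpectrum R, p < q → t q + 1 ≤ t p := by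
    intro p q hpq
    have hp := p.2
    have hq := q.2
    have hle : p.asIdeal ≤ q.asIdeal := hpq.le
    obtain ⟨z, hzq, hzp⟩ : ∃ z ∈ q.asIdeal, z ∉ p.asIdeal :=
      SetLike.not_le_iff_exists.mp (fun h => hpq.not_ge h)
    have := kd_trdeg_lt (K := K) (Ideal.Quotient.factorₐ K hle)
      (Ideal.Quotient.factor_surjective hle)
      (Ideal.Quotient.mk _ z) (by rwa [Ne, Ideal.Quotient.eq_zero_iff_mem])
      (by
        change Ideal.Quotient.mk q.asIdeal z = 0
        rwa [Ideal.Quotient.eq_zero_iff_mem])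
    rw [ht, ht] at this
    exact_mod_cast this
  refine iSup_le fun s => ?_
  have : ∀ i : ℕ, ∀ hi : i < s.length + 1, t (s ⟨i, hi⟩) + i ≤ t (s ⟨0, by omega⟩) := by
    intro i
    induction i with
    | zero => intro _; simp
    | succ i ih =>
      intro hi
      have h1 := ih (by omega)
      have h2 := hanti (s ⟨i, by omega⟩) (s ⟨i+1, hi⟩) (s.strictMono (by simp [Fin.lt_def]))
      omega
  have h3 := this s.length (by omega)
  have h4 := htd (s ⟨0, by omega⟩)
  have : s.length ≤ d := by omega
  exact_mod_cast this

theorem kd_upper {K σ : Type} [Field K] [Fintype σ] (I : Ideal (MvPolynomial σ K)) (d : ℕ)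
    (lt : σ → σ → Prop) (wf : WellFounded lt)
    (bound : ∀ W : Finset σ, (∀ c ∈ W, ∀ e ∈ W, ¬ ∃ a b, lt a c ∧ lt b c ∧ lt e c ∧
      (MvPolynomial.X c * MvPolynomial.X e - MvPolynomial.X a * MvPolynomial.X b :
        MvPolynomial σ K) ∈ I) → W.card ≤ d) :
    ringKrullDim (MvPolynomial σ K ⧸ I) ≤ d := by
  apply kd_krullDim_le (K := K)
  intro p hp
  refine kd_trdeg_le I d lt wf bound
    ((Ideal.Quotient.mkₐ K p).comp (Ideal.Quotient.mkₐ K I))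
    ((Ideal.Quotient.mkₐ_surjective K _).comp (Ideal.Quotient.mkₐ_surjective K _)) ?_
  intro q hq
  have : (Ideal.Quotient.mkₐ K I) q = 0 := Ideal.Quotient.eq_zero_iff_mem.mpr hq
  rw [AlgHom.comp_apply, this, map_zero]

open MvPolynomial in
theorem kd_lower {K σ τ : Type} [Field K] [DecidableEq τ] (I : Ideal (MvPolynomial σ K))
    (val : σ → MvPolynomial τ K) (hI : ∀ q ∈ I, aeval val q = 0)
    (F : Finset τ) (vert : τ → σ) (lvl : τ → ℕ)
    (hF : ∀ f ∈ F, ∃ M : Finset τ, (∀ g ∈ M, g ∈ F ∧ lvl g < lvl f) ∧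
      val (vert f) = X f * ∏ g ∈ M, X g) :
    (F.card : WithBot ℕ∞) ≤ ringKrullDim (MvPolynomial σ K ⧸ I) := by
  classical
  let R := MvPolynomial σ K ⧸ I
  let θ : Finset τ → (MvPolynomial τ K →ₐ[K] MvPolynomial τ K) :=
    fun T => aeval fun f => if f ∈ T then 1 else X f
  let ψ0 : R →ₐ[K] MvPolynomial τ K := Ideal.Quotient.liftₐ I (aeval val) hI
  let ψ : Finset τ → (R →ₐ[K] MvPolynomial τ K) := fun T => (θ T).comp ψ0
  let J : Finset τ → PrimeSpectrum R := fun T => ⟨RingHom.ker (ψ T), RingHom.ker_isPrime _⟩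
  have hψX : ∀ T v, ψ T (Ideal.Quotient.mk I (X v)) = θ T (val v) := by
    intro T v
    simp only [ψ, ψ0, AlgHom.comp_apply]
    congr 1
    exact (Ideal.Quotient.liftₐ_apply I (aeval val) hI _).trans
      ((Ideal.Quotient.lift_mk I _ _).trans (by simp))
  have hcomp : ∀ T f, θ (insert f T) = (θ {f}).comp (θ T) := by
    intro T f
    apply MvPolynomial.algHom_ext
    intro g
    simp only [θ, aeval_X, AlgHom.comp_apply, Finset.mem_insert]
    by_cases h1 : g ∈ T
    · simp [h1]
    · by_cases h2 : g = f
      · subst h2; simp [h1]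
      · simp [h1, h2]
  have step : ∀ T f, f ∉ T → (∃ M : Finset τ, M ⊆ T ∧ val (vert f) = X f * ∏ g ∈ M, X g) →
      J T < J (insert f T) := by
    rintro T f hf ⟨M, hM, hval⟩
    have hprod : ∀ T', M ⊆ T' → θ T' (∏ g ∈ M, X g) = 1 := by
      intro T' hT'
      rw [map_prod]
      apply Finset.prod_eq_one
      intro g hg
      simp [θ, hT' hg]
    have hle : J T ≤ J (insert f T) := by
      intro q hq
      have hq' : ψ T q = 0 := hq
      change ψ (insert f T) q = 0
      simp only [ψ, AlgHom.comp_apply] at hq' ⊢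
      rw [hcomp, AlgHom.comp_apply, hq', map_zero]
    refine lt_of_le_not_ge hle ?_
    intro hge
    have h1 : Ideal.Quotient.mk I (X (vert f)) - 1 ∈ (J (insert f T)).asIdeal := by
      change ψ (insert f T) _ = 0
      rw [map_sub, hψX, hval, map_mul, hprod _ (hM.trans (Finset.subset_insert _ _))]
      simp [θ]
    have h2 : ψ T (Ideal.Quotient.mk I (X (vert f)) - 1) = 0 := hge h1
    rw [map_sub, hψX, hval, map_mul, hprod _ hM] at h2
    simp only [θ, aeval_X, if_neg hf, mul_one, map_one] at h2
    have h3 := congrArg (aeval (fun _ : τ => (0 : K))) h2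
    simp at h3
  have main : ∀ T : Finset τ, (∀ f ∈ T, f ∈ F ∧ ∀ g ∈ F, lvl g < lvl f → g ∈ T) →
      (T.card : ℕ∞) ≤ Order.height (J T) := by
    intro T
    induction T using Finset.induction_on_max_value lvl with
    | empty => intro _; simp
    | insert f T hf hmax ih =>
      intro h
      have hT : ∀ g ∈ T, g ∈ F ∧ ∀ g' ∈ F, lvl g' < lvl g → g' ∈ T := by
        intro g hg
        obtain ⟨h1, h2⟩ := h g (Finset.mem_insert_of_mem hg)
        refine ⟨h1, fun g' hg' hl => ?_⟩
        rcases Finset.mem_insert.mp (h2 g' hg' hl) with rfl | h3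
        · have := hmax g hg; omega
        · exact h3
      obtain ⟨hfF, hfd⟩ := h f (Finset.mem_insert_self _ _)
      obtain ⟨M, hM, hval⟩ := hF f hfF
      have hs := step T f hf ⟨M, fun g hg => by
        obtain ⟨h1, h2⟩ := hM g hg
        rcases Finset.mem_insert.mp (hfd g h1 h2) with rfl | h3
        · omega
        · exact h3, hval⟩
      rw [Finset.card_insert_of_notMem hf]
      push_cast
      exact (add_le_add_left (ih hT) 1).trans (Order.height_add_one_le hs)
  have h1 := main F (fun f hf => ⟨hf, fun g hg _ => hg⟩)
  have h2 := Order.height_le_krullDim (J F)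
  refine le_trans ?_ h2
  exact_mod_cast h1

theorem nep_le (p : ℤ × ℤ) (t : List (ℤ × ℤ))
    (h : List.IsChain (fun u v : ℤ × ℤ => v = (u.1 + 1, u.2) ∨ v = (u.1, u.2 + 1)) (p :: t)) :
    ∀ u ∈ p :: t, p.1 ≤ u.1 ∧ p.2 ≤ u.2 := by
  induction t generalizing p with
  | nil => intro u hu; simp at hu; subst hu; simp
  | cons r t ih =>
    rw [List.isChain_cons_cons] at h
    intro u hu
    rcases List.mem_cons.mp hu with rfl | hu
    · simp
    · have := ih r h.2 u hu
      rcases h.1 with rfl | rfl <;> simp at this ⊢ <;> omega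

theorem nep_comparable (p : ℤ × ℤ) (t : List (ℤ × ℤ))
    (h : List.IsChain (fun u v : ℤ × ℤ => v = (u.1 + 1, u.2) ∨ v = (u.1, u.2 + 1)) (p :: t)) :
    ∀ u ∈ p :: t, ∀ v ∈ p :: t, (u.1 ≤ v.1 ∧ u.2 ≤ v.2) ∨ (v.1 ≤ u.1 ∧ v.2 ≤ u.2) := by
  induction t generalizing p with
  | nil => intro u hu v hv; simp at hu hv; subst hu; subst hv; simp
  | cons r t ih =>
    intro u hu v hv
    have h1 := nep_le p _ h u hu
    have h2 := nep_le p _ h v hv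
    rw [List.isChain_cons_cons] at h
    rcases List.mem_cons.mp hu with rfl | hu
    · exact Or.inl h2
    · rcases List.mem_cons.mp hv with rfl | hv
      · exact Or.inr h1
      · exact ih r h.2 u hu v hv

theorem nep_east (p q : ℤ × ℤ) (t : List (ℤ × ℤ))
    (h : List.IsChain (fun u v : ℤ × ℤ => v = (u.1 + 1, u.2) ∨ v = (u.1, u.2 + 1)) (p :: t))
    (hq : (p :: t).getLast? = some q) (x : ℤ) (hx : p.1 ≤ x) (hx' : x < q.1) :
    ∃ y, eastStepOf (p :: t) x y := by
  induction t generalizing p with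
  | nil => simp at hq; subst hq; omega
  | cons r t ih =>
    rw [List.isChain_cons_cons] at h
    have hq' : (r :: t).getLast? = some q := by simpa using hq
    by_cases hr : r.1 ≤ x
    · obtain ⟨y, hy⟩ := ih r h.2 hq' hr
      refine ⟨y, ?_⟩
      unfold eastStepOf at hy ⊢
      simp only [List.tail_cons] at hy ⊢
      cases t with
      | nil => simp at hy
      | cons s t =>
        rw [List.zip_cons_cons]
        exact List.mem_cons_of_mem _ hy
    · refine ⟨p.2, ?_⟩
      rcases h.1 with rfl | rfl
      · simp at hr
        have : p.1 = x := by omega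
        unfold eastStepOf
        simp [← this]
      · simp at hr; omega

theorem nep_penult (p q : ℤ × ℤ) (t : List (ℤ × ℤ))
    (h : List.IsChain (fun u v : ℤ × ℤ => v = (u.1 + 1, u.2) ∨ v = (u.1, u.2 + 1)) (p :: t))
    (hq : (p :: t).getLast? = some q) (hpq : p ≠ q) :
    (q.1 - 1, q.2) ∈ p :: t ∨ (q.1, q.2 - 1) ∈ p :: t := by
  induction t generalizing p with
  | nil => simp at hq; exact absurd hq hpq
  | cons r t ih =>
    rw [List.isChain_cons_cons] at h
    have hq' : (r :: t).getLast? = some q := by simpa using hq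
    by_cases hr : r = q
    · subst hr
      rcases h.1 with h1 | h1
      · left; rw [h1]; simp
      · right; rw [h1]; simp
    · rcases ih r h.2 hq' hr with h1 | h1
      · left; exact List.mem_cons_of_mem _ h1
      · right; exact List.mem_cons_of_mem _ h1

theorem nep_interior (p q : ℤ × ℤ) (t : List (ℤ × ℤ)) (hq : (p :: t).getLast? = some q)
    (u : ℤ × ℤ) (hu : u ∈ p :: t) (hp : u ≠ p) (huq : u ≠ q) : u ∈ interiorPts (p :: t) := by
  unfold interiorPts
  have hu' : u ∈ t := by simpa [hp] using hu
  have hne : t ≠ [] := List.ne_nil_of_mem hu'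
  simp only [List.drop_succ_cons, List.drop_zero]
  have hl : t.getLast hne = q := by
    rw [List.getLast?_cons] at hq
    simp [List.getLast?_eq_getLast_of_ne_nil hne] at hq
    exact hq
  have := List.dropLast_append_getLast hne
  rw [← this, hl] at hu'
  simpa [huq] using hu'

/-- Summary of what is needed about a north-east path. -/
structure PathFacts (L : List (ℤ × ℤ)) (a0 b0 ak bk : ℤ) : Prop where
  cmp : ∀ x y x' y' : ℤ, (x, y) ∈ L → (x', y') ∈ L → (x ≤ x' ∧ y ≤ y') ∨ (x' ≤ x ∧ y' ≤ y)
  lo : ∀ x y : ℤ, (x, y) ∈ L → a0 ≤ x ∧ b0 ≤ y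
  hi : ∀ x y : ℤ, (x, y) ∈ L → x ≤ ak ∧ y ≤ bk
  east : ∀ x, a0 ≤ x → x < ak → ∃ y, eastStepOf L x y
  eastMem : ∀ x y, eastStepOf L x y → (x, y) ∈ L ∧ (x + 1, y) ∈ L
  first : (a0 + 1, b0) ∈ L ∨ (a0, b0 + 1) ∈ L
  pen : (ak - 1, bk) ∈ L ∨ (ak, bk - 1) ∈ L
  int : ∀ x y : ℤ, (x, y) ∈ L → (x, y) ≠ (a0, b0) → (x, y) ≠ (ak, bk) → (x, y) ∈ interiorPts L

theorem pathFacts (L : List (ℤ × ℤ)) (a0 b0 ak bk : ℤ) (hL : IsNEPath L)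
    (hh : L.head? = some (a0, b0)) (hl : L.getLast? = some (ak, bk)) (h : a0 < ak) :
    PathFacts L a0 b0 ak bk := by
  obtain ⟨hne, hc⟩ := hL
  cases L with
  | nil => simp at hne
  | cons p t =>
    simp at hh
    subst hh
    replace hc : List.IsChain (fun u v : ℤ × ℤ => v = (u.1 + 1, u.2) ∨ v = (u.1, u.2 + 1))
      ((a0, b0) :: t) := hc
    have hneq : ((a0, b0) : ℤ × ℤ) ≠ (ak, bk) := by
      intro h'; simp at h'; omega
    have hlm : (ak, bk) ∈ (a0, b0) :: t := List.mem_of_getLast? hl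
    have hem : ∀ x y, eastStepOf ((a0, b0) :: t) x y →
        (x, y) ∈ (a0, b0) :: t ∧ (x + 1, y) ∈ (a0, b0) :: t := by
      intro x y he
      have := List.of_mem_zip he
      exact ⟨this.1, List.mem_of_mem_tail this.2⟩
    have hcmp := nep_comparable _ _ hc
    have hlo := nep_le _ _ hc
    have hhi : ∀ u ∈ (a0, b0) :: t, u.1 ≤ ak ∧ u.2 ≤ bk := by
      clear hem hcmp hlo h hneq hlm hne
      generalize (a0, b0) = p at *
      induction t generalizing p with
      | nil => simp at hl; subst hl; intro u hu; simp at hu; subst hu; simp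
      | cons r t ih =>
        have hlast : (ak, bk) ∈ p :: r :: t := List.mem_of_getLast? hl
        have h0 := nep_le _ _ hc _ hlast
        rw [List.isChain_cons_cons] at hc
        have hl' : (r :: t).getLast? = some (ak, bk) := by simpa using hl
        intro u hu
        rcases List.mem_cons.mp hu with rfl | hu
        · exact h0
        · exact ih r hl' hc.2 u hu
    refine ⟨?_, ?_, ?_, ?_, hem, ?_, ?_, ?_⟩
    · intro x y x' y' h1 h2
      exact hcmp _ h1 _ h2
    · intro x y h1; exact hlo _ h1
    · intro x y h1; exact hhi _ h1
    · intro x h1 h2; exact nep_east _ _ _ hc hl x h1 h2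
    · cases t with
      | nil => simp at hl; omega
      | cons r t =>
        rw [List.isChain_cons_cons] at hc
        rcases hc.1 with h1 | h1
        · left; rw [h1]; simp
        · right; rw [h1]; simp
    · exact nep_penult _ _ _ hc hl hneq
    · intro x y h1 h2 h3
      exact nep_interior _ _ _ hl _ h1 h2 h3

/-- The shape of the hole, column by column. -/
structure HoleShape (H : Set (ℤ × ℤ)) (a0 b0 ak bk : ℤ) (h1 h2 : ℤ → ℤ) : Prop where
  mem : ∀ x y : ℤ, (x, y) ∈ H ↔ a0 ≤ x ∧ x < ak ∧ h2 x ≤ y ∧ y < h1 x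
  mono1 : ∀ x y, a0 ≤ x → x ≤ y → y < ak → h1 x ≤ h1 y
  mono2 : ∀ x y, a0 ≤ x → x ≤ y → y < ak → h2 x ≤ h2 y
  top : h1 (ak - 1) = bk
  bot : h2 a0 = b0
  lt : ∀ x, a0 ≤ x → x < ak → h2 x < h1 x
  conn : ∀ x, a0 ≤ x → x + 1 < ak → h2 (x + 1) < h1 x

theorem PathFacts.uniq {L : List (ℤ × ℤ)} {a0 b0 ak bk : ℤ} (F : PathFacts L a0 b0 ak bk)
    (x y y' : ℤ) (h : eastStepOf L x y) (h' : eastStepOf L x y') : y = y' := by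
  have h1 := F.eastMem _ _ h
  have h2 := F.eastMem _ _ h'
  have h3 := F.cmp _ _ _ _ h1.1 h2.2
  have h4 := F.cmp _ _ _ _ h1.2 h2.1
  omega

theorem PathFacts.mono {L : List (ℤ × ℤ)} {a0 b0 ak bk : ℤ} (F : PathFacts L a0 b0 ak bk)
    (x x' y y' : ℤ) (hx : x ≤ x') (h : eastStepOf L x y) (h' : eastStepOf L x' y') : y ≤ y' := by
  have h1 := F.eastMem _ _ h
  have h2 := F.eastMem _ _ h'
  have h3 := F.cmp _ _ _ _ h1.1 h2.2
  omega

theorem hole_shape (S1 S2 : List (ℤ × ℤ)) (a0 b0 ak bk : ℤ) (hab : a0 < ak) (hbb : b0 < bk)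
    (F1 : PathFacts S1 a0 b0 ak bk) (F2 : PathFacts S2 a0 b0 ak bk) (ab : LiesAbove S1 S2) :
    parCells S1 S2 = ∅ ∨ ∃ h1 h2, HoleShape (parCells S1 S2) a0 b0 ak bk h1 h2 := by
  have e1 : ∀ x, ∃ y, a0 ≤ x → x < ak → eastStepOf S1 x y := by
    intro x
    by_cases hx : a0 ≤ x ∧ x < ak
    · obtain ⟨y, hy⟩ := F1.east x hx.1 hx.2
      exact ⟨y, fun _ _ => hy⟩
    · exact ⟨0, fun h1 h2 => absurd ⟨h1, h2⟩ hx⟩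
  have e2 : ∀ x, ∃ y, a0 ≤ x → x < ak → eastStepOf S2 x y := by
    intro x
    by_cases hx : a0 ≤ x ∧ x < ak
    · obtain ⟨y, hy⟩ := F2.east x hx.1 hx.2
      exact ⟨y, fun _ _ => hy⟩
    · exact ⟨0, fun h1 h2 => absurd ⟨h1, h2⟩ hx⟩
  choose h1 H1 using e1
  choose h2 H2 using e2
  have hmem : ∀ x y : ℤ, (x, y) ∈ parCells S1 S2 ↔ a0 ≤ x ∧ x < ak ∧ h2 x ≤ y ∧ y < h1 x := by
    intro x y
    constructor
    · rintro ⟨⟨u, hu, hyu⟩, ⟨v, hv, hvy⟩⟩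
      simp only at hu hyu hv hvy
      have m := F1.eastMem _ _ hu
      have hx0 := (F1.lo _ _ m.1).1
      have hx1 := (F1.hi _ _ m.2).1
      have hu' := F1.uniq _ _ _ hu (H1 x hx0 (by omega))
      have hv' := F2.uniq _ _ _ hv (H2 x hx0 (by omega))
      omega
    · rintro ⟨q1, q2, q3, q4⟩
      exact ⟨⟨h1 x, H1 x q1 q2, q4⟩, ⟨h2 x, H2 x q1 q2, q3⟩⟩
  have hA : ∀ x y y' : ℤ, (x, y) ∈ S1 → (x, y') ∈ S2 → (x, y) ≠ (a0, b0) → (x, y) ≠ (ak, bk) →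
      (x, y') ≠ (a0, b0) → (x, y') ≠ (ak, bk) → y' < y := by
    intro x y y' m1 m2 n1 n2 n3 n4
    exact ab _ (F1.int _ _ m1 n1 n2) _ (F2.int _ _ m2 n3 n4) rfl
  simp only [Ne, Prod.mk.injEq, not_and] at hA
  have M1 := F1.eastMem _ _ (H1 (ak - 1) (by omega) (by omega))
  have M2 := F2.eastMem _ _ (H2 (ak - 1) (by omega) (by omega))
  have N1 := F1.eastMem _ _ (H1 a0 (by omega) (by omega))
  have N2 := F2.eastMem _ _ (H2 a0 (by omega) (by omega))
  rw [sub_add_cancel] at M1 M2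
  rcases F1.pen with p1 | p1
  · -- good case
    right
    have top : h1 (ak - 1) = bk := by
      have := F1.cmp _ _ _ _ M1.2 p1
      have := F1.hi _ _ M1.2
      omega
    have bot : h2 a0 = b0 := by
      rcases F2.first with f2 | f2
      · have := F2.cmp _ _ _ _ N2.1 f2
        have := F2.lo _ _ N2.1
        omega
      · exfalso
        rcases F1.first with f1 | f1
        · by_cases hk : a0 + 1 = ak
          · have := F1.cmp _ _ _ _ f1 p1
            omega
          · have h3 := F2.cmp _ _ _ _ N2.2 f2
            have := hA _ _ _ f1 N2.2 (by omega) (by omega) (by omega) (by omega)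
            omega
        · have := hA _ _ _ f1 f2 (by omega) (by omega) (by omega) (by omega)
          omega
    have m1 : ∀ x y, a0 ≤ x → x ≤ y → y < ak → h1 x ≤ h1 y := fun x y q1 q2 q3 =>
      F1.mono _ _ _ _ q2 (H1 x q1 (by omega)) (H1 y (by omega) q3)
    have m2 : ∀ x y, a0 ≤ x → x ≤ y → y < ak → h2 x ≤ h2 y := fun x y q1 q2 q3 =>
      F2.mono _ _ _ _ q2 (H2 x q1 (by omega)) (H2 y (by omega) q3)
    have conn : ∀ x, a0 ≤ x → x + 1 < ak → h2 (x + 1) < h1 x := by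
      intro x q1 q2
      exact hA _ _ _ (F1.eastMem _ _ (H1 x q1 (by omega))).2
        (F2.eastMem _ _ (H2 (x + 1) (by omega) q2)).1
        (by omega) (by omega) (by omega) (by omega)
    refine ⟨h1, h2, hmem, m1, m2, top, bot, ?_, conn⟩
    intro x q1 q2
    by_cases q3 : x + 1 < ak
    · have := conn x q1 q3
      have := m2 x (x + 1) q1 (by omega) q3
      omega
    · have hx : x = ak - 1 := by omega
      subst hx
      by_cases q4 : a0 + 1 = ak
      · have : ak - 1 = a0 := by omega
        rw [top, this, bot]; exact hbb
      · have c := conn (ak - 2) (by omega) (by omega)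
        have := m1 (ak - 2) (ak - 1) (by omega) (by omega) (by omega)
        rw [show ak - 2 + 1 = ak - 1 by ring] at c
        omega
  · -- S1 ends with a north step
    left
    rcases F2.pen with p2 | p2
    · have i1 : h1 (ak - 1) ≤ bk - 1 := by
        have := F1.cmp _ _ _ _ M1.1 p1
        omega
      have i2 : h2 (ak - 1) = bk := by
        have := F2.cmp _ _ _ _ M2.2 p2
        have := F2.hi _ _ M2.2
        omega
      by_cases hk : a0 + 1 = ak
      · ext ⟨x, y⟩
        rw [hmem]
        simp only [Set.mem_empty_iff_false, iff_false]
        rintro ⟨q1, q2, q3, q4⟩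
        have : x = ak - 1 := by omega
        subst this
        omega
      · exfalso
        have := hA _ _ _ M1.1 p2 (by omega) (by omega) (by omega) (by omega)
        omega
    · exfalso
      have := hA _ _ _ p1 p2 (by omega) (by omega) (by omega) (by omega)
      omega

/-- The upper left quadrant at `v` does not meet the hole. -/
def QA (H : Set (ℤ × ℤ)) (v : ℤ × ℤ) : Prop := ∀ x y : ℤ, (x, y) ∈ H → x < v.1 → y < v.2

/-- The lower right quadrant at `v` does not meet the hole. -/
def QB (H : Set (ℤ × ℤ)) (v : ℤ × ℤ) : Prop := ∀ x y : ℤ, (x, y) ∈ H → v.1 ≤ x → v.2 ≤ y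

/-- What is used about the hole in all cases. -/
structure HoleOK (H : Set (ℤ × ℤ)) (a0 b0 ak bk : ℤ) : Prop where
  box : ∀ x y : ℤ, (x, y) ∈ H → a0 ≤ x ∧ x < ak ∧ b0 ≤ y ∧ y < bk
  inner : ∀ x1 y1 x2 y2 : ℤ, x1 < x2 → y1 < y2 →
    (∀ x y : ℤ, x1 ≤ x → x < x2 → y1 ≤ y → y < y2 → (x, y) ∉ H) → QA H (x2, y1) ∨ QB H (x1, y2)
  vert : ∀ x y : ℤ, ¬ QA H (x, y) → ¬ QB H (x, y) →
    (x, y) ∈ H ∧ (x - 1, y) ∈ H ∧ (x, y - 1) ∈ H ∧ (x - 1, y - 1) ∈ H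

theorem holeOK_empty (a0 b0 ak bk : ℤ) : HoleOK ∅ a0 b0 ak bk := by
  refine ⟨?_, ?_, ?_⟩
  · intro x y h; simp at h
  · intro x1 y1 x2 y2 _ _ _; left; intro x y h; simp at h
  · intro x y h; exact absurd (fun x y h => by simp at h) h

theorem HoleShape.ok {H : Set (ℤ × ℤ)} {a0 b0 ak bk : ℤ} {h1 h2 : ℤ → ℤ}
    (S : HoleShape H a0 b0 ak bk h1 h2) : HoleOK H a0 b0 ak bk := by
  refine ⟨?_, ?_, ?_⟩
  · intro x y h
    rw [S.mem] at h
    have := S.mono1 x (ak - 1) h.1 (by omega) (by omega)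
    have := S.mono2 a0 x (by omega) h.1 (by omega)
    have := S.top
    have := S.bot
    omega
  · intro x1 y1 x2 y2 hx hy hno
    by_contra hcon
    simp only [QA, QB, not_or, not_forall] at hcon
    obtain ⟨⟨ex, ey, he, he1, he2⟩, ⟨fx, fy, hf, hf1, hf2⟩⟩ := hcon
    rw [S.mem] at he hf
    have key : ∀ x, x1 ≤ x → x < x2 → a0 ≤ x → x < ak → h2 x < y2 → h1 x ≤ y1 := by
      intro x q1 q2 q3 q4 q5
      by_contra q6
      have hl := S.lt x q3 q4
      refine hno x (max (h2 x) y1) q1 q2 (le_max_right _ _) (by omega) ?_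
      rw [S.mem]
      omega
    by_cases c1 : ex < x1
    · have := key x1 le_rfl hx (by omega) (by omega)
      have := S.mono1 ex x1 (by omega) (by omega) (by omega)
      have := S.mono2 x1 fx (by omega) (by omega) (by omega)
      omega
    by_cases c2 : ex ≤ fx
    · have := key ex (by omega) he1 (by omega) (by omega)
      have := S.mono2 ex fx (by omega) (by omega) (by omega)
      omega
    have ind : ∀ x, fx ≤ x → x ≤ ex → h2 x < y2 := by
      intro x q
      induction x, q using Int.leInduction with
      | base => intro _; omega
      | succ x q ih =>
        intro q2
        have := ih (by omega)
        have := key x (by omega) (by omega) (by omega) (by omega) this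
        have := S.conn x (by omega) (by omega)
        omega
    have := key ex (by omega) he1 (by omega) (by omega) (ind ex (by omega) le_rfl)
    omega
  · intro x y hA hB
    simp only [QA, QB, not_forall] at hA hB
    obtain ⟨ex, ey, he, he1, he2⟩ := hA
    obtain ⟨fx, fy, hf, hf1, hf2⟩ := hB
    simp only [S.mem] at he hf ⊢
    have := S.mono1 ex (x - 1) (by omega) (by omega) (by omega)
    have := S.mono1 (x - 1) x (by omega) (by omega) (by omega)
    have := S.mono2 x fx (by omega) (by omega) (by omega)
    have := S.mono2 (x - 1) x (by omega) (by omega) (by omega)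
    omega

theorem HoleShape.AB {H : Set (ℤ × ℤ)} {a0 b0 ak bk : ℤ} {h1 h2 : ℤ → ℤ} (hab : a0 < ak)
    (S : HoleShape H a0 b0 ak bk h1 h2) (x y : ℤ) (hA : QA H (x, y)) (hB : QB H (x, y)) :
    (x ≤ a0 ∧ y ≤ b0) ∨ (ak ≤ x ∧ bk ≤ y) := by
  have hl := S.lt a0 le_rfl hab
  have hl2 := S.lt (ak - 1) (by omega) (by omega)
  have hb := S.bot
  have ht := S.top
  have p0 : (a0, b0) ∈ H := by rw [S.mem]; omega
  have p1 : (ak - 1, bk - 1) ∈ H := by rw [S.mem]; omega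
  have i1 := hA _ _ p0
  have i2 := hB _ _ p0
  have i3 := hA _ _ p1
  have i4 := hB _ _ p1
  simp only at i1 i2 i3 i4
  by_cases c1 : x ≤ a0
  · omega
  by_cases c2 : ak ≤ x
  · omega
  exfalso
  have cn := S.conn (x - 1) (by omega) (by omega)
  rw [sub_add_cancel] at cn
  have l1 := S.lt x (by omega) (by omega)
  have l2 := S.lt (x - 1) (by omega) (by omega)
  have q1 : (x - 1, h1 (x - 1) - 1) ∈ H := by rw [S.mem]; omega
  have q2 : (x, h2 x) ∈ H := by rw [S.mem]; omega
  have := hA _ _ q1 (by simp)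
  have := hB _ _ q2 (by simp)
  simp only at *
  omega

theorem HoleShape.corner {H : Set (ℤ × ℤ)} {a0 b0 ak bk : ℤ} {h1 h2 : ℤ → ℤ} (hab : a0 < ak)
    (S : HoleShape H a0 b0 ak bk h1 h2) : (ak - 1, bk - 1) ∈ H := by
  have hl2 := S.lt (ak - 1) (by omega) (by omega)
  have ht := S.top
  rw [S.mem]; omega

/-- a set of pairwise comparable points in a rectangle is small -/
theorem chain_card (W : Finset (ℤ × ℤ)) (x0 y0 x1 y1 : ℤ) (hx : x0 ≤ x1) (hy : y0 ≤ y1)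
    (hin : ∀ u ∈ W, x0 ≤ u.1 ∧ u.1 ≤ x1 ∧ y0 ≤ u.2 ∧ u.2 ≤ y1)
    (hc : ∀ u ∈ W, ∀ v ∈ W, ¬ (u.1 < v.1 ∧ v.2 < u.2)) :
    (W.card : ℤ) ≤ x1 + y1 - x0 - y0 + 1 := by
  have h1 : W.card ≤ (Finset.Icc (x0 + y0) (x1 + y1)).card := by
    apply Finset.card_le_card_of_injOn (fun u => u.1 + u.2)
    · intro u hu
      have := hin u hu
      simp; omega
    · intro u hu v hv huv
      have := hc u hu v hv
      have := hc v hv u hu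
      simp only at huv
      ext <;> omega
  rw [Int.card_Icc] at h1
  omega

theorem upper_count (A B : ℤ × ℤ → Prop) (m n a0 b0 ak bk : ℤ) (ha0 : 1 < a0) (hak : a0 < ak)
    (ham : ak < m) (hb0 : 1 < b0) (hbk : b0 < bk) (hbn : bk < n)
    (hR0 : ∀ x y : ℤ, x ≤ a0 → y ≤ b0 → A (x, y) ∧ B (x, y))
    (hR1 : ∀ x y : ℤ, ak ≤ x → bk ≤ y → A (x, y) ∧ B (x, y))
    (hAB : ∀ x y : ℤ, A (x, y) → B (x, y) → (x ≤ a0 ∧ y ≤ b0) ∨ (ak ≤ x ∧ bk ≤ y))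
    (hnB : ∀ x y : ℤ, ¬ B (x, y) → x ≤ ak - 1 ∧ b0 + 1 ≤ y)
    (hnA : ∀ x y : ℤ, ¬ A (x, y) → a0 + 1 ≤ x ∧ y ≤ bk - 1)
    (W : Finset (ℤ × ℤ)) (hW : ∀ x y : ℤ, (x, y) ∈ W → 1 ≤ x ∧ x ≤ m ∧ 1 ≤ y ∧ y ≤ n)
    (hAorB : ∀ v ∈ W, A v ∨ B v)
    (hcA : ∀ u ∈ W, ∀ v ∈ W, A u → A v → ¬ (u.1 < v.1 ∧ v.2 < u.2))
    (hcB : ∀ u ∈ W, ∀ v ∈ W, B u → B v → ¬ (u.1 < v.1 ∧ v.2 < u.2)) :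
    (W.card : ℤ) ≤ m + n + (ak - a0) + (bk - b0) - 2 := by
  classical
  have hp : ∃ p1 p2 : ℤ, 1 ≤ p1 ∧ p1 ≤ a0 ∧ 1 ≤ p2 ∧ p2 ≤ b0 ∧
      (∀ u ∈ W, u.1 ≤ a0 → u.2 ≤ b0 → u.1 ≤ p1 ∧ u.2 ≤ p2) ∧
      (∀ u ∈ W, ¬ (u.1 ≤ a0 ∧ u.2 ≤ b0) → p1 ≤ u.1 ∧ p2 ≤ u.2) := by
    rcases (W.filter fun u => u.1 ≤ a0 ∧ u.2 ≤ b0).eq_empty_or_nonempty with he | hne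
    · refine ⟨1, 1, by omega, by omega, by omega, by omega, ?_, ?_⟩
      · intro u hu h1 h2
        have : u ∈ W.filter fun u => u.1 ≤ a0 ∧ u.2 ≤ b0 := by simp [hu, h1, h2]
        rw [he] at this; simp at this
      · intro u hu _
        have := hW u.1 u.2 hu
        omega
    · obtain ⟨p, hp, hmax⟩ := Finset.exists_max_image _ (fun u : ℤ × ℤ => u.1 + u.2) hne
      simp only [Finset.mem_filter] at hp hmax
      have hpr := hW p.1 p.2 hp.1
      have hpAB := hR0 p.1 p.2 hp.2.1 hp.2.2
      have cmp : ∀ u ∈ W, ¬ (u.1 < p.1 ∧ p.2 < u.2) ∧ ¬ (p.1 < u.1 ∧ u.2 < p.2) := by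
        intro u hu
        rcases hAorB u hu with h | h
        · exact ⟨hcA u hu p hp.1 h hpAB.1, hcA p hp.1 u hu hpAB.1 h⟩
        · exact ⟨hcB u hu p hp.1 h hpAB.2, hcB p hp.1 u hu hpAB.2 h⟩
      refine ⟨p.1, p.2, by omega, by omega, by omega, by omega, ?_, ?_⟩
      · intro u hu h1 h2
        have := hmax u ⟨hu, h1, h2⟩
        have := cmp u hu
        omega
      · intro u hu h1
        have := cmp u hu
        omega
  have hq : ∃ q1 q2 : ℤ, ak ≤ q1 ∧ q1 ≤ m ∧ bk ≤ q2 ∧ q2 ≤ n ∧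
      (∀ u ∈ W, ak ≤ u.1 → bk ≤ u.2 → q1 ≤ u.1 ∧ q2 ≤ u.2) ∧
      (∀ u ∈ W, ¬ (ak ≤ u.1 ∧ bk ≤ u.2) → u.1 ≤ q1 ∧ u.2 ≤ q2) := by
    rcases (W.filter fun u => ak ≤ u.1 ∧ bk ≤ u.2).eq_empty_or_nonempty with he | hne
    · refine ⟨m, n, by omega, by omega, by omega, by omega, ?_, ?_⟩
      · intro u hu h1 h2
        have : u ∈ W.filter fun u => ak ≤ u.1 ∧ bk ≤ u.2 := by simp [hu, h1, h2]
        rw [he] at this; simp at this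
      · intro u hu _
        have := hW u.1 u.2 hu
        omega
    · obtain ⟨p, hp, hmax⟩ := Finset.exists_min_image _ (fun u : ℤ × ℤ => u.1 + u.2) hne
      simp only [Finset.mem_filter] at hp hmax
      have hpr := hW p.1 p.2 hp.1
      have hpAB := hR1 p.1 p.2 hp.2.1 hp.2.2
      have cmp : ∀ u ∈ W, ¬ (u.1 < p.1 ∧ p.2 < u.2) ∧ ¬ (p.1 < u.1 ∧ u.2 < p.2) := by
        intro u hu
        rcases hAorB u hu with h | h
        · exact ⟨hcA u hu p hp.1 h hpAB.1, hcA p hp.1 u hu hpAB.1 h⟩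
        · exact ⟨hcB u hu p hp.1 h hpAB.2, hcB p hp.1 u hu hpAB.2 h⟩
      refine ⟨p.1, p.2, by omega, by omega, by omega, by omega, ?_, ?_⟩
      · intro u hu h1 h2
        have := hmax u ⟨hu, h1, h2⟩
        have := cmp u hu
        omega
      · intro u hu h1
        have := cmp u hu
        omega
  obtain ⟨p1, p2, i1, i2, i3, i4, hp1, hp2⟩ := hp
  obtain ⟨q1, q2, j1, j2, j3, j4, hq1, hq2⟩ := hq
  have s1 := Finset.card_filter_add_card_filter_not (s := W) (fun u : ℤ × ℤ => u.1 ≤ a0 ∧ u.2 ≤ b0)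
  set W1 := W.filter fun u : ℤ × ℤ => ¬ (u.1 ≤ a0 ∧ u.2 ≤ b0) with hW1
  have s2 := Finset.card_filter_add_card_filter_not (s := W1) (fun u : ℤ × ℤ => ak ≤ u.1 ∧ bk ≤ u.2)
  set W2 := W1.filter fun u : ℤ × ℤ => ¬ (ak ≤ u.1 ∧ bk ≤ u.2) with hW2
  have s3 := Finset.card_filter_add_card_filter_not (s := W2) A
  have t1 := chain_card (W.filter fun u : ℤ × ℤ => u.1 ≤ a0 ∧ u.2 ≤ b0) 1 1 p1 p2 i1 i3
    (by
      intro u hu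
      rw [Finset.mem_filter] at hu
      have := hW u.1 u.2 hu.1
      have := hp1 u hu.1 hu.2.1 hu.2.2
      omega)
    (by
      intro u hu v hv
      rw [Finset.mem_filter] at hu hv
      exact hcA u hu.1 v hv.1 (hR0 u.1 u.2 hu.2.1 hu.2.2).1 (hR0 v.1 v.2 hv.2.1 hv.2.2).1)
  have t2 := chain_card (W1.filter fun u : ℤ × ℤ => ak ≤ u.1 ∧ bk ≤ u.2) q1 q2 m n j2 j4
    (by
      intro u hu
      rw [Finset.mem_filter, hW1, Finset.mem_filter] at hu
      have := hW u.1 u.2 hu.1.1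
      have := hq1 u hu.1.1 hu.2.1 hu.2.2
      omega)
    (by
      intro u hu v hv
      rw [Finset.mem_filter, hW1, Finset.mem_filter] at hu hv
      exact hcA u hu.1.1 v hv.1.1 (hR1 u.1 u.2 hu.2.1 hu.2.2).1 (hR1 v.1 v.2 hv.2.1 hv.2.2).1)
  have t3 := chain_card (W2.filter A) p1 (b0 + 1) (ak - 1) q2 (by omega) (by omega)
    (by
      intro u hu
      rw [Finset.mem_filter, hW2, Finset.mem_filter, hW1, Finset.mem_filter] at hu
      obtain ⟨⟨⟨k1, k2⟩, k3⟩, k4⟩ := hu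
      have k5 : ¬ B (u.1, u.2) := fun h => by
        have := hAB u.1 u.2 k4 h
        tauto
      have := hnB _ _ k5
      have := hp2 u k1 k2
      have := hq2 u k1 k3
      omega)
    (by
      intro u hu v hv
      rw [Finset.mem_filter, hW2, Finset.mem_filter, hW1, Finset.mem_filter] at hu hv
      exact hcA u hu.1.1.1 v hv.1.1.1 hu.2 hv.2)
  have t4 := chain_card (W2.filter fun u => ¬ A u) (a0 + 1) p2 q1 (bk - 1) (by omega) (by omega)
    (by
      intro u hu
      rw [Finset.mem_filter, hW2, Finset.mem_filter, hW1, Finset.mem_filter] at hu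
      obtain ⟨⟨⟨k1, k2⟩, k3⟩, k4⟩ := hu
      have := hnA u.1 u.2 k4
      have := hp2 u k1 k2
      have := hq2 u k1 k3
      omega)
    (by
      intro u hu v hv
      rw [Finset.mem_filter, hW2, Finset.mem_filter, hW1, Finset.mem_filter] at hu hv
      exact hcB u hu.1.1.1 v hv.1.1.1 ((hAorB u hu.1.1.1).resolve_left hu.2)
        ((hAorB v hv.1.1.1).resolve_left hv.2))
  omega

/-- `P` is the rectangle minus the set `H`. -/
def IsRectMinus (P : Polyomino) (H : Set (ℤ × ℤ)) (m n : ℤ) : Prop :=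
  ∀ x y : ℤ, (x, y) ∈ P.cells ↔ 1 ≤ x ∧ x < m ∧ 1 ≤ y ∧ y < n ∧ (x, y) ∉ H

theorem mem_vertexSet (P : Polyomino) (x y : ℤ) : (x, y) ∈ P.vertexSet ↔
    (x, y) ∈ P.cells ∨ (x - 1, y) ∈ P.cells ∨ (x, y - 1) ∈ P.cells ∨ (x - 1, y - 1) ∈ P.cells := by
  unfold Polyomino.vertexSet cellVertices
  simp only [Finset.mem_biUnion, Finset.mem_insert, Finset.mem_singleton, Prod.mk.injEq,
    Prod.exists]
  constructor
  · rintro ⟨a, b, h, ⟨rfl, rfl⟩ | ⟨rfl, rfl⟩ | ⟨rfl, rfl⟩ | ⟨rfl, rfl⟩⟩ <;> simp [h]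
  · rintro (h | h | h | h)
    · exact ⟨_, _, h, by simp⟩
    · exact ⟨_, _, h, by simp⟩
    · exact ⟨_, _, h, by simp⟩
    · exact ⟨_, _, h, by simp⟩

theorem vert_iff (P : Polyomino) (H : Set (ℤ × ℤ)) (m n a0 b0 ak bk : ℤ)
    (ha0 : 1 < a0) (hak : a0 < ak) (ham : ak < m) (hb0 : 1 < b0) (hbk : b0 < bk) (hbn : bk < n)
    (hP : IsRectMinus P H m n) (ok : HoleOK H a0 b0 ak bk) (x y : ℤ) :
    (x, y) ∈ P.vertexSet ↔ (1 ≤ x ∧ x ≤ m ∧ 1 ≤ y ∧ y ≤ n) ∧ (QA H (x, y) ∨ QB H (x, y)) := by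
  rw [mem_vertexSet]
  simp only [hP _ _]
  constructor
  · intro h
    refine ⟨by omega, ?_⟩
    by_contra hc
    rw [not_or] at hc
    have := ok.vert x y hc.1 hc.2
    tauto
  · rintro ⟨hr, h⟩
    have e1 := ok.box x y
    have e2 := ok.box (x - 1) y
    have e3 := ok.box x (y - 1)
    have e4 := ok.box (x - 1) (y - 1)
    rcases h with h | h
    · have f := h (x - 1) y
      simp only at f
      by_cases c0 : x = 1
      · by_cases c1 : y = n
        · right; right; left
          refine ⟨by omega, by omega, by omega, by omega, fun hh => ?_⟩
          have := e3 hh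
          omega
        · left
          refine ⟨by omega, by omega, by omega, by omega, fun hh => ?_⟩
          have := e1 hh
          omega
      · by_cases c1 : y = n
        · right; right; right
          refine ⟨by omega, by omega, by omega, by omega, fun hh => ?_⟩
          have := e4 hh
          omega
        · right; left
          refine ⟨by omega, by omega, by omega, by omega, fun hh => ?_⟩
          have := f hh
          omega
    · have f := h x (y - 1)
      simp only at f
      by_cases c0 : x = m
      · by_cases c1 : y = 1
        · right; left
          refine ⟨by omega, by omega, by omega, by omega, fun hh => ?_⟩
          have := e2 hh
          omega
        · right; right; right
          refine ⟨by omega, by omega, by omega, by omega, fun hh => ?_⟩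
          have := e4 hh
          omega
      · by_cases c1 : y = 1
        · left
          refine ⟨by omega, by omega, by omega, by omega, fun hh => ?_⟩
          have := e1 hh
          omega
        · right; right; left
          refine ⟨by omega, by omega, by omega, by omega, fun hh => ?_⟩
          have := f hh
          omega

theorem tele (f g : ℤ → ℤ) (a k : ℤ) (hk : a + 1 ≤ k) :
    ∑ x ∈ Finset.Ico a k, (f x - g x) - ∑ x ∈ Finset.Ico (a + 1) k, (f (x - 1) - g x - 1)
      = f (k - 1) - g a + (k - a - 1) := by
  induction k, hk using Int.leInduction with
  | base =>
    have : Finset.Ico a (a + 1) = {a} := by ext; simp; omega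
    rw [this]; simp
  | succ k hk ih =>
    have e1 : Finset.Ico a (k + 1) = insert k (Finset.Ico a k) := by
      ext; simp; omega
    have e2 : Finset.Ico (a + 1) (k + 1) = insert k (Finset.Ico (a + 1) k) := by
      ext; simp; omega
    rw [e1, e2, Finset.sum_insert (by simp), Finset.sum_insert (by simp)]
    rw [add_sub_cancel_right]
    linarith

theorem col_card (s : Finset ℤ) (lo hi : ℤ → ℤ) (h : ∀ x ∈ s, lo x ≤ hi x) (T : Finset (ℤ × ℤ))
    (hT : ∀ x y : ℤ, (x, y) ∈ T ↔ x ∈ s ∧ lo x ≤ y ∧ y < hi x) :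
    (T.card : ℤ) = ∑ x ∈ s, (hi x - lo x) := by
  have : T = s.biUnion fun x => (Finset.Ico (lo x) (hi x)).image fun y => (x, y) := by
    ext ⟨x, y⟩
    rw [hT]
    simp only [Finset.mem_biUnion, Finset.mem_image, Finset.mem_Ico, Prod.mk.injEq]
    constructor
    · rintro ⟨h1, h2⟩; exact ⟨x, h1, y, h2, rfl, rfl⟩
    · rintro ⟨x', h1, y', h2, rfl, rfl⟩; exact ⟨h1, h2⟩
  rw [this, Finset.card_biUnion]
  · push_cast
    apply Finset.sum_congr rfl
    intro x hx
    rw [Finset.card_image_of_injective _ (fun a b hab => by simpa using hab), Int.card_Ico]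
    have := h x hx
    omega
  · intro x hx x' hx' hne
    rw [Function.onFun, Finset.disjoint_left]
    rintro ⟨u, v⟩ h1 h2
    simp only [Finset.mem_image, Prod.mk.injEq] at h1 h2
    obtain ⟨_, _, rfl, _⟩ := h1
    obtain ⟨_, _, rfl, _⟩ := h2
    exact hne rfl

theorem rect_card (x0 x1 y0 y1 : ℤ) (hx : x0 ≤ x1 + 1) (hy : y0 ≤ y1 + 1) :
    ((Finset.Icc x0 x1 ×ˢ Finset.Icc y0 y1).card : ℤ) = (x1 + 1 - x0) * (y1 + 1 - y0) := by
  rw [Finset.card_product, Int.card_Icc, Int.card_Icc]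
  push_cast
  rw [Int.toNat_of_nonneg (by omega), Int.toNat_of_nonneg (by omega)]

theorem count_empty (P : Polyomino) (m n a0 b0 ak bk : ℤ)
    (ha0 : 1 < a0) (hak : a0 < ak) (ham : ak < m) (hb0 : 1 < b0) (hbk : b0 < bk) (hbn : bk < n)
    (hP : IsRectMinus P ∅ m n) :
    (P.vertexSet.card : ℤ) - P.rank = m + n - 1 := by
  have hv : P.vertexSet = Finset.Icc 1 m ×ˢ Finset.Icc 1 n := by
    ext ⟨x, y⟩
    rw [vert_iff P ∅ m n a0 b0 ak bk ha0 hak ham hb0 hbk hbn hP (holeOK_empty _ _ _ _)]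
    simp [QA, and_assoc]
  have hc : P.cells = Finset.Icc 1 (m - 1) ×ˢ Finset.Icc 1 (n - 1) := by
    ext ⟨x, y⟩
    rw [hP]
    simp; omega
  rw [Polyomino.rank, hv, hc, rect_card _ _ _ _ (by omega) (by omega),
    rect_card _ _ _ _ (by omega) (by omega)]
  ring

theorem count_shape (P : Polyomino) (H : Set (ℤ × ℤ)) (m n a0 b0 ak bk : ℤ) (h1 h2 : ℤ → ℤ)
    (ha0 : 1 < a0) (hak : a0 < ak) (ham : ak < m) (hb0 : 1 < b0) (hbk : b0 < bk) (hbn : bk < n)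
    (hP : IsRectMinus P H m n) (S : HoleShape H a0 b0 ak bk h1 h2) :
    (P.vertexSet.card : ℤ) - P.rank = m + n + (ak - a0) + (bk - b0) - 2 := by
  classical
  have ok := S.ok
  have vi := vert_iff P H m n a0 b0 ak bk ha0 hak ham hb0 hbk hbn hP ok
  have sub1 : P.vertexSet ⊆ Finset.Icc 1 m ×ˢ Finset.Icc 1 n := by
    rintro ⟨x, y⟩ h
    rw [vi] at h
    simp; omega
  have sub2 : P.cells ⊆ Finset.Icc 1 (m - 1) ×ˢ Finset.Icc 1 (n - 1) := by
    rintro ⟨x, y⟩ h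
    rw [hP] at h
    simp; omega
  have c1 := Finset.card_sdiff_add_card_eq_card sub1
  have c2 := Finset.card_sdiff_add_card_eq_card sub2
  have d1 := col_card (Finset.Ico a0 ak) h2 h1
    (fun x hx => by
      rw [Finset.mem_Ico] at hx
      exact (S.lt x hx.1 hx.2).le)
    ((Finset.Icc 1 (m - 1) ×ˢ Finset.Icc 1 (n - 1)) \ P.cells)
    (by
      intro x y
      have := ok.box x y
      have hm := S.mem x y
      simp only [Finset.mem_sdiff, Finset.mem_product, Finset.mem_Icc, hP x y, Finset.mem_Ico]
      constructor
      · rintro ⟨q1, q2⟩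
        have : (x, y) ∈ H := by
          by_contra hh
          exact q2 ⟨by omega, by omega, by omega, by omega, hh⟩
        rw [hm] at this
        omega
      · intro q
        have hh : (x, y) ∈ H := hm.2 (by omega)
        have := this hh
        exact ⟨by omega, fun q => q.2.2.2.2 hh⟩)
  have d2 := col_card (Finset.Ico (a0 + 1) ak) (fun x => h2 x + 1) (fun x => h1 (x - 1))
    (fun x hx => by
      rw [Finset.mem_Ico] at hx
      have := S.conn (x - 1) (by omega) (by omega)
      rw [sub_add_cancel] at this
      omega)
    ((Finset.Icc 1 m ×ˢ Finset.Icc 1 n) \ P.vertexSet)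
    (by
      intro x y
      simp only [Finset.mem_sdiff, Finset.mem_product, Finset.mem_Icc, vi x y, Finset.mem_Ico]
      constructor
      · rintro ⟨q1, q2⟩
        have q3 : ¬ QA H (x, y) := fun h => q2 ⟨by omega, Or.inl h⟩
        have q4 : ¬ QB H (x, y) := fun h => q2 ⟨by omega, Or.inr h⟩
        have := ok.vert x y q3 q4
        simp only [S.mem] at this
        omega
      · rintro ⟨q1, q2, q3⟩
        have mo1 := S.mono1 (x - 1) x (by omega) (by omega) (by omega)
        have mo2 := S.mono2 (x - 1) x (by omega) (by omega) (by omega)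
        have r1 : (x, y - 1) ∈ H := by rw [S.mem]; omega
        have r2 : (x - 1, y) ∈ H := by rw [S.mem]; omega
        have b1 := ok.box _ _ r1
        have b2 := ok.box _ _ r2
        refine ⟨by omega, ?_⟩
        rintro ⟨-, q | q⟩
        · have := q _ _ r2 (by simp)
          simp at this
        · have := q _ _ r1 (by simp)
          simp at this)
  have tl := tele h1 h2 a0 ak (by omega)
  have e : ∑ x ∈ Finset.Ico (a0 + 1) ak, (h1 (x - 1) - (h2 x + 1)) =
      ∑ x ∈ Finset.Ico (a0 + 1) ak, (h1 (x - 1) - h2 x - 1) :=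
    Finset.sum_congr rfl fun x _ => by ring
  rw [e] at d2
  have r1 := rect_card 1 m 1 n (by omega) (by omega)
  have r2 := rect_card 1 (m - 1) 1 (n - 1) (by omega) (by omega)
  rw [S.top, S.bot] at tl
  have r3 : (m + 1 - 1) * (n + 1 - 1) - (m - 1 + 1 - 1) * (n - 1 + 1 - 1) = m + n - 1 := by ring
  rw [Polyomino.rank]
  zify at c1 c2
  linarith

theorem QA_mono {H : Set (ℤ × ℤ)} {x y x' y' : ℤ} (h : QA H (x, y)) (hx : x' ≤ x) (hy : y ≤ y') :
    QA H (x', y') := by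
  intro u v hm hu
  have := h u v hm (by simp only at hu ⊢; omega)
  simp only at this ⊢
  omega

theorem QB_mono {H : Set (ℤ × ℤ)} {x y x' y' : ℤ} (h : QB H (x, y)) (hx : x ≤ x') (hy : y' ≤ y) :
    QB H (x', y') := by
  intro u v hm hu
  have := h u v hm (by simp only at hu ⊢; omega)
  simp only at this ⊢
  omega

theorem neg_minor_mem (K : Type) [Field K] (P : Polyomino) (a b c e : PVertex P)
    (h : IsInnerInterval P a.1 b.1) (hc : c.1 = (a.1.1, b.1.2)) (he : e.1 = (b.1.1, a.1.2)) :
    (MvPolynomial.X c * MvPolynomial.X e - MvPolynomial.X a * MvPolynomial.X b : PolyRing K P) ∈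
      polyIdeal K P := by
  have h1 : (MvPolynomial.X a * MvPolynomial.X b - MvPolynomial.X c * MvPolynomial.X e :
      PolyRing K P) ∈ polyIdeal K P := Ideal.subset_span ⟨a, b, c, e, h, hc, he, rfl⟩
  have h2 := (polyIdeal K P).neg_mem h1
  rwa [neg_sub] at h2

theorem upper_main (K : Type) [Field K] (P : Polyomino) (H : Set (ℤ × ℤ)) (m n a0 b0 ak bk : ℤ)
    (ha0 : 1 < a0) (hak : a0 < ak) (ham : ak < m) (hb0 : 1 < b0) (hbk : b0 < bk) (hbn : bk < n)
    (hP : IsRectMinus P H m n) (ok : HoleOK H a0 b0 ak bk) (d : ℕ)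
    (hd : ∀ W : Finset (ℤ × ℤ), (∀ x y : ℤ, (x, y) ∈ W → 1 ≤ x ∧ x ≤ m ∧ 1 ≤ y ∧ y ≤ n) →
      (∀ v ∈ W, QA H v ∨ QB H v) →
      (∀ u ∈ W, ∀ v ∈ W, QA H u → QA H v → ¬ (u.1 < v.1 ∧ v.2 < u.2)) →
      (∀ u ∈ W, ∀ v ∈ W, QB H u → QB H v → ¬ (u.1 < v.1 ∧ v.2 < u.2)) → W.card ≤ d) :
    ringKrullDim (CoordRing K P) ≤ d := by
  have vi := vert_iff P H m n a0 b0 ak bk ha0 hak ham hb0 hbk hbn hP ok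
  let lt : PVertex P → PVertex P → Prop := fun u v =>
    v.1.1 < u.1.1 ∨ (u.1.1 = v.1.1 ∧ u.1.2 < v.1.2)
  have irr : Std.Irrefl lt := ⟨fun u h => by simp only [lt] at h; omega⟩
  have tr : IsTrans (PVertex P) lt := ⟨fun u v w h h' => by simp only [lt] at h h' ⊢; omega⟩
  have wf : WellFounded lt := Finite.wellFounded_of_trans_of_irrefl lt
  apply kd_upper (polyIdeal K P) d lt wf
  intro W hW
  have main : ∀ u ∈ W, ∀ v ∈ W, (QA H v.1 ∨ QB H u.1) → ¬ (u.1.1 < v.1.1 ∧ v.1.2 < u.1.2) := by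
    rintro ⟨⟨cx, cy⟩, hc⟩ huW ⟨⟨ex, ey⟩, he⟩ hvW hAB ⟨h1, h2⟩
    simp only at h1 h2 hAB
    have hc' := (vi cx cy).1 hc
    have he' := (vi ex ey).1 he
    have ha : (cx, ey) ∈ P.vertexSet := by
      rw [vi]
      refine ⟨by omega, ?_⟩
      rcases hAB with h | h
      · exact Or.inl (QA_mono h h1.le le_rfl)
      · exact Or.inr (QB_mono h le_rfl h2.le)
    have hb : (ex, cy) ∈ P.vertexSet := by
      rw [vi]
      refine ⟨by omega, ?_⟩
      rcases hAB with h | h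
      · exact Or.inl (QA_mono h le_rfl h2.le)
      · exact Or.inr (QB_mono h h1.le le_rfl)
    refine hW _ huW _ hvW ⟨⟨(cx, ey), ha⟩, ⟨(ex, cy), hb⟩, ?_, ?_, ?_, ?_⟩
    · right; exact ⟨rfl, h2⟩
    · left; exact h1
    · left; exact h1
    · refine neg_minor_mem K P ⟨(cx, ey), ha⟩ ⟨(ex, cy), hb⟩ _ _ ⟨h1, h2, ?_⟩ rfl rfl
      rintro ⟨x, y⟩ ⟨k1, k2, k3, k4⟩
      simp only at k1 k2 k3 k4
      rw [hP]
      refine ⟨by omega, by omega, by omega, by omega, fun hh => ?_⟩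
      rcases hAB with h | h
      · have := h _ _ hh (by simp only; omega)
        simp only at this
        omega
      · have := h _ _ hh (by simp only; omega)
        simp only at this
        omega
  have := hd (W.map (Function.Embedding.subtype _)) ?_ ?_ ?_ ?_
  · simpa using this
  · intro x y h
    rw [Finset.mem_map] at h
    obtain ⟨⟨v, hv⟩, h, rfl⟩ := h
    exact ((vi x y).1 hv).1
  · intro v h
    rw [Finset.mem_map] at h
    obtain ⟨⟨v, hv⟩, h, rfl⟩ := h
    exact ((vi v.1 v.2).1 hv).2
  · intro u hu v hv _ hA
    rw [Finset.mem_map] at hu hv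
    obtain ⟨u, hu, rfl⟩ := hu
    obtain ⟨v, hv, rfl⟩ := hv
    exact main u hu v hv (Or.inl hA)
  · intro u hu v hv hB _
    rw [Finset.mem_map] at hu hv
    obtain ⟨u, hu, rfl⟩ := hu
    obtain ⟨v, hv, rfl⟩ := hv
    exact main u hu v hv (Or.inr hB)

theorem lower_main (K : Type) [Field K] (P : Polyomino) (H : Set (ℤ × ℤ)) (m n a0 b0 ak bk : ℤ)
    (ha0 : 1 < a0) (hak : a0 < ak) (ham : ak < m) (hb0 : 1 < b0) (hbk : b0 < bk) (hbn : bk < n)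
    (hP : IsRectMinus P H m n) (ok : HoleOK H a0 b0 ak bk)
    (val : ℤ × ℤ → MvPolynomial (ℤ × ℤ) K)
    (hA : ∀ x1 y1 x2 y2 : ℤ, x1 < x2 → y1 < y2 → QA H (x2, y1) →
      val (x1, y1) * val (x2, y2) = val (x1, y2) * val (x2, y1))
    (hB : ∀ x1 y1 x2 y2 : ℤ, x1 < x2 → y1 < y2 → QB H (x1, y2) →
      val (x1, y1) * val (x2, y2) = val (x1, y2) * val (x2, y1))
    (F : Finset (ℤ × ℤ)) (lvl : ℤ × ℤ → ℕ) (hFV : ∀ f ∈ F, f ∈ P.vertexSet)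
    (hF : ∀ f ∈ F, ∃ M : Finset (ℤ × ℤ), (∀ g ∈ M, g ∈ F ∧ lvl g < lvl f) ∧
      val f = MvPolynomial.X f * ∏ g ∈ M, MvPolynomial.X g) :
    (F.card : WithBot ℕ∞) ≤ ringKrullDim (CoordRing K P) := by
  classical
  have h11 : (1, 1) ∈ P.vertexSet := by
    rw [vert_iff P H m n a0 b0 ak bk ha0 hak ham hb0 hbk hbn hP ok]
    refine ⟨by omega, Or.inl ?_⟩
    intro x y h h'
    have := ok.box _ _ h
    simp only at h' ⊢
    omega
  refine kd_lower (polyIdeal K P) (fun v => val v.1) ?_ F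
    (fun f => if h : f ∈ P.vertexSet then ⟨f, h⟩ else ⟨(1, 1), h11⟩) lvl ?_
  · have : polyIdeal K P ≤ RingHom.ker
        (MvPolynomial.aeval (R := K) (fun v : PVertex P => val v.1)).toRingHom := by
      unfold polyIdeal
      rw [Ideal.span_le]
      rintro f ⟨⟨⟨x1, y1⟩, _⟩, ⟨⟨x2, y2⟩, _⟩, c, e, ⟨i1, i2, i3⟩, hc, he, rfl⟩
      simp only at i1 i2 hc he
      have key : val (x1, y1) * val (x2, y2) = val (x1, y2) * val (x2, y1) := by
        rcases ok.inner x1 y1 x2 y2 i1 i2 (by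
          intro x y k1 k2 k3 k4
          exact ((hP _ _).1 (i3 (x, y) ⟨k1, by simp only; omega, k3, by simp only; omega⟩)).2.2.2.2)
          with h | h
        · exact hA _ _ _ _ i1 i2 h
        · exact hB _ _ _ _ i1 i2 h
      simp [RingHom.mem_ker, hc, he, key]
    intro q hq
    exact this hq
  · intro f hf
    obtain ⟨M, h1, h2⟩ := hF f hf
    exact ⟨M, h1, by simp only [dif_pos (hFV f hf)]; exact h2⟩

theorem lower_empty (K : Type) [Field K] (P : Polyomino) (m n a0 b0 ak bk : ℤ)
    (ha0 : 1 < a0) (hak : a0 < ak) (ham : ak < m) (hb0 : 1 < b0) (hbk : b0 < bk) (hbn : bk < n)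
    (hP : IsRectMinus P ∅ m n) (d : ℕ) (hd : (d : ℤ) = m + n - 1) :
    (d : WithBot ℕ∞) ≤ ringKrullDim (CoordRing K P) := by
  classical
  let al : ℤ → MvPolynomial (ℤ × ℤ) K := fun i => MvPolynomial.X (i, 1)
  let be : ℤ → MvPolynomial (ℤ × ℤ) K := fun j => if j = 1 then 1 else MvPolynomial.X (1, j)
  let F : Finset (ℤ × ℤ) := (Finset.Icc 1 m ×ˢ {1}) ∪ ({1} ×ˢ Finset.Icc 2 n)
  have hc : F.card = d := by
    simp only [F]
    rw [Finset.card_union_of_disjoint]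
    · simp only [Finset.card_product, Int.card_Icc, Finset.card_singleton]
      omega
    · rw [Finset.disjoint_left]
      rintro ⟨x, y⟩ h1 h2
      simp at h1 h2
      omega
  rw [← hc]
  refine lower_main K P ∅ m n a0 b0 ak bk ha0 hak ham hb0 hbk hbn hP (holeOK_empty _ _ _ _)
    (fun v => al v.1 * be v.2) ?_ ?_ F (fun v => if v.2 = 1 then 0 else 1) ?_ ?_
  · intros; simp only; ring
  · intros; simp only; ring
  · rintro ⟨x, y⟩ h
    rw [vert_iff P ∅ m n a0 b0 ak bk ha0 hak ham hb0 hbk hbn hP (holeOK_empty _ _ _ _)]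
    refine ⟨?_, Or.inl (fun x y h => by simp at h)⟩
    simp [F] at h
    omega
  · rintro ⟨x, y⟩ h
    by_cases hy : y = 1
    · refine ⟨∅, by simp, ?_⟩
      simp [al, be, hy]
    · have hx : x = 1 := by simp [F] at h; omega
      refine ⟨{(1, 1)}, ?_, ?_⟩
      · simp [F, hy]; omega
      · simp [al, be, hy, hx, mul_comm]

theorem lower_shape (K : Type) [Field K] (P : Polyomino) (H : Set (ℤ × ℤ)) (m n a0 b0 ak bk : ℤ)
    (ha0 : 1 < a0) (hak : a0 < ak) (ham : ak < m) (hb0 : 1 < b0) (hbk : b0 < bk) (hbn : bk < n)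
    (hP : IsRectMinus P H m n) (ok : HoleOK H a0 b0 ak bk)
    (hAB : ∀ x y : ℤ, QA H (x, y) → QB H (x, y) → (x ≤ a0 ∧ y ≤ b0) ∨ (ak ≤ x ∧ bk ≤ y))
    (hcor : (ak - 1, bk - 1) ∈ H)
    (d : ℕ) (hd : (d : ℤ) = m + n + (ak - a0) + (bk - b0) - 2) :
    (d : WithBot ℕ∞) ≤ ringKrullDim (CoordRing K P) := by
  classical
  let al : ℤ → MvPolynomial (ℤ × ℤ) K := fun i => MvPolynomial.X (i, 1)
  let be : ℤ → MvPolynomial (ℤ × ℤ) K := fun j => if j = 1 then 1 else MvPolynomial.X (1, j)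
  let ca : ℤ → MvPolynomial (ℤ × ℤ) K := fun i =>
    if a0 < i ∧ i < ak then MvPolynomial.X (i, n) else al i
  let rb : ℤ → MvPolynomial (ℤ × ℤ) K := fun j =>
    if b0 < j ∧ j < bk then MvPolynomial.X (m, j) else be j
  let uu : ℤ × ℤ → MvPolynomial (ℤ × ℤ) K := fun v =>
    if ak ≤ v.1 ∧ bk ≤ v.2 then MvPolynomial.X (m, n) else 1
  let val : ℤ × ℤ → MvPolynomial (ℤ × ℤ) K := fun v =>
    uu v * (if QA H v then ca v.1 * be v.2 else al v.1 * rb v.2)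
  have valA : ∀ x y, QA H (x, y) → val (x, y) = uu (x, y) * (ca x * be y) := by
    intro x y h
    simp only [val, if_pos h]
  have valB : ∀ x y, QB H (x, y) → val (x, y) = uu (x, y) * (al x * rb y) := by
    intro x y h
    by_cases h' : QA H (x, y)
    · rw [valA x y h']
      have := hAB x y h' h
      simp only [ca, rb]
      rw [if_neg (by omega), if_neg (by omega)]
    · simp only [val, if_neg h']
  have ueqA : ∀ x1 y1 x2 y2 : ℤ, x1 < x2 → y1 < y2 → (QA H (x2, y1) ∨ QB H (x1, y2)) →
      uu (x1, y1) * uu (x2, y2) = uu (x1, y2) * uu (x2, y1) := by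
    intro x1 y1 x2 y2 h1 h2 h
    have h' : ¬ (x1 < ak ∧ ak ≤ x2 ∧ y1 < bk ∧ bk ≤ y2) := by
      intro q
      rcases h with h | h
      · have := h _ _ hcor (by simp only; omega)
        simp only at this
        omega
      · have := h _ _ hcor (by simp only; omega)
        simp only at this
        omega
    simp only [uu]
    by_cases k1 : ak ≤ x1
    · have k2 : ak ≤ x2 := by omega
      simp [k1, k2, mul_comm]
    · by_cases k2 : ak ≤ x2
      · by_cases k3 : bk ≤ y2
        · have k4 : bk ≤ y1 := by omega
          simp [k1, k2, k3, k4]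
        · have k4 : ¬ bk ≤ y1 := by omega
          simp [k3, k4]
      · simp [k1, k2]
  let F : Finset (ℤ × ℤ) := (((((Finset.Icc 1 m ×ˢ {1}) ∪ ({1} ×ˢ Finset.Icc 2 n)) ∪
    (Finset.Ioo a0 ak ×ˢ {n})) ∪ ({m} ×ˢ Finset.Ioo b0 bk)) ∪ {(m, n)})
  have memF : ∀ x y : ℤ, (x, y) ∈ F ↔ (1 ≤ x ∧ x ≤ m ∧ y = 1) ∨ (x = 1 ∧ 2 ≤ y ∧ y ≤ n) ∨
      (a0 < x ∧ x < ak ∧ y = n) ∨ (x = m ∧ b0 < y ∧ y < bk) ∨ (x = m ∧ y = n) := by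
    intro x y
    simp only [F, Finset.mem_union, Finset.mem_product, Finset.mem_Icc, Finset.mem_Ioo,
      Finset.mem_singleton, Prod.mk.injEq]
    omega
  have hc : F.card = d := by
    simp only [F]
    rw [Finset.card_union_of_disjoint, Finset.card_union_of_disjoint,
      Finset.card_union_of_disjoint, Finset.card_union_of_disjoint]
    · simp only [Finset.card_product, Int.card_Icc, Int.card_Ioo, Finset.card_singleton]
      omega
    all_goals
      rw [Finset.disjoint_left]
      rintro ⟨x, y⟩ h1 h2
      simp only [Finset.mem_union, Finset.mem_product, Finset.mem_Icc, Finset.mem_Ioo,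
        Finset.mem_singleton, Prod.mk.injEq] at h1 h2
      omega
  have QA1 : ∀ x y : ℤ, x ≤ a0 ∨ bk ≤ y → QA H (x, y) := by
    intro x y h u v hh hu
    have := ok.box _ _ hh
    simp only at hu ⊢
    omega
  have QB1 : ∀ x y : ℤ, y ≤ b0 ∨ ak ≤ x → QB H (x, y) := by
    intro x y h u v hh hu
    have := ok.box _ _ hh
    simp only at hu ⊢
    omega
  rw [← hc]
  refine lower_main K P H m n a0 b0 ak bk ha0 hak ham hb0 hbk hbn hP ok val ?_ ?_ F
    (fun v => if v.2 = 1 then 0 else if v.1 = 1 then 1 else if v = (m, n) then 4 else 2) ?_ ?_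
  · intro x1 y1 x2 y2 h1 h2 h
    rw [valA x2 y1 h, valA x1 y1 (QA_mono h h1.le le_rfl), valA x2 y2 (QA_mono h le_rfl h2.le),
      valA x1 y2 (QA_mono h h1.le h2.le)]
    linear_combination (ca x1 * be y1 * (ca x2 * be y2)) * ueqA x1 y1 x2 y2 h1 h2 (Or.inl h)
  · intro x1 y1 x2 y2 h1 h2 h
    rw [valB x1 y2 h, valB x1 y1 (QB_mono h le_rfl h2.le), valB x2 y2 (QB_mono h h1.le le_rfl),
      valB x2 y1 (QB_mono h h1.le h2.le)]
    linear_combination (al x1 * rb y1 * (al x2 * rb y2)) * ueqA x1 y1 x2 y2 h1 h2 (Or.inr h)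
  · rintro ⟨x, y⟩ h
    rw [vert_iff P H m n a0 b0 ak bk ha0 hak ham hb0 hbk hbn hP ok]
    rw [memF] at h
    refine ⟨by omega, ?_⟩
    by_cases k : x ≤ a0 ∨ bk ≤ y
    · exact Or.inl (QA1 x y k)
    · exact Or.inr (QB1 x y (by omega))
  · rintro ⟨x, y⟩ h
    rw [memF] at h
    rcases h with ⟨k1, k2, rfl⟩ | ⟨rfl, k1, k2⟩ | ⟨k1, k2, rfl⟩ | ⟨rfl, k1, k2⟩ | ⟨rfl, rfl⟩
    · refine ⟨∅, by simp, ?_⟩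
      rw [valB _ _ (QB1 _ _ (by omega))]
      simp only [uu, al, rb, be]
      rw [if_neg (by omega), if_neg (by omega)]
      simp
    · refine ⟨{(1, 1)}, ?_, ?_⟩
      · intro g hg
        rw [Finset.mem_singleton] at hg
        subst hg
        refine ⟨(memF _ _).2 (by omega), ?_⟩
        have e1 : ¬ y = 1 := by omega
        simp [e1]
      · rw [valA _ _ (QA1 _ _ (by omega))]
        simp only [uu, al, ca, be]
        rw [if_neg (by omega), if_neg (by omega), if_neg (by omega)]
        simp [mul_comm]
    · refine ⟨{(1, y)}, ?_, ?_⟩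
      · intro g hg
        rw [Finset.mem_singleton] at hg
        subst hg
        refine ⟨(memF _ _).2 (by omega), ?_⟩
        have e1 : ¬ y = 1 := by omega
        have e2 : ¬ x = 1 := by omega
        have e3 : ¬ x = m := by omega
        simp [e1, e2, e3]
      · rw [valA _ _ (QA1 _ _ (by omega))]
        simp only [uu, al, ca, be]
        rw [if_neg (by omega), if_pos (by omega), if_neg (by omega)]
        simp
    · refine ⟨{(x, 1)}, ?_, ?_⟩
      · intro g hg
        rw [Finset.mem_singleton] at hg
        subst hg
        refine ⟨(memF _ _).2 (by omega), ?_⟩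
        have e1 : ¬ y = 1 := by omega
        have e2 : ¬ x = 1 := by omega
        have e3 : ¬ y = n := by omega
        simp [e1, e2, e3]
      · rw [valB _ _ (QB1 _ _ (by omega))]
        simp only [uu, al, rb, be]
        rw [if_neg (by omega), if_pos (by omega)]
        simp [mul_comm]
    · refine ⟨{(x, 1), (1, y)}, ?_, ?_⟩
      · intro g hg
        rw [Finset.mem_insert, Finset.mem_singleton] at hg
        have e1 : ¬ y = 1 := by omega
        have e2 : ¬ x = 1 := by omega
        have e3 : ¬ 1 = y := by omega
        have e4 : ¬ 1 = x := by omega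
        rcases hg with rfl | rfl
        · exact ⟨(memF _ _).2 (by omega), by simp [e1, e2]⟩
        · exact ⟨(memF _ _).2 (by omega), by simp [e1, e2]⟩
      · rw [valA _ _ (QA1 _ _ (by omega))]
        simp only [uu, al, ca, be]
        rw [if_pos (by omega), if_neg (by omega), if_neg (by omega),
          Finset.prod_insert, Finset.prod_singleton]
        simp
        omega

theorem frame_krull_dimension (K : Type) [Field K] (P : Polyomino)
    (D : FrameData) (hP : IsFrame P D) :
    ∃ d : ℕ, ringKrullDim (CoordRing K P) = (d : WithBot (WithTop ℕ)) ∧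
      d + P.rank = P.vertexSet.card := by
  obtain ⟨m, n, S1, S2, a0, b0, ak, bk, par, head1, last1, ha0, hak, ham, hb0, hbk, hbn⟩ := D
  have F1 := pathFacts S1 a0 b0 ak bk par.ne1 head1 last1 hak
  have F2 := pathFacts S2 a0 b0 ak bk par.ne2 (par.headEq ▸ head1) (par.lastEq ▸ last1) hak
  have hP' : IsRectMinus P (parCells S1 S2) m n := by
    intro x y
    rw [← Finset.mem_coe, hP]
    simp only [FrameData.rectCells, FrameData.holeCells, Set.mem_sdiff, Set.mem_setOf_eq]
    constructor
    · rintro ⟨h, h'⟩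
      exact ⟨by omega, by omega, by omega, by omega, h'⟩
    · rintro ⟨h1, h2, h3, h4, h'⟩
      exact ⟨by omega, h'⟩
  rcases hole_shape S1 S2 a0 b0 ak bk hak hbk F1 F2 par.above with he | ⟨h1, h2, S⟩
  · rw [he] at hP'
    have ct := count_empty P m n a0 b0 ak bk ha0 hak ham hb0 hbk hbn hP'
    have hd : (((m + n - 1).toNat : ℕ) : ℤ) = m + n - 1 := by omega
    refine ⟨(m + n - 1).toNat, le_antisymm ?_ ?_, by omega⟩
    · apply upper_main K P ∅ m n a0 b0 ak bk ha0 hak ham hb0 hbk hbn hP' (holeOK_empty _ _ _ _)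
      intro W w1 w2 w3 w4
      have all : ∀ v, QA ∅ v := fun v x y h => by simp at h
      have := chain_card W 1 1 m n (by omega) (by omega)
        (fun u hu => by have := w1 u.1 u.2 hu; omega)
        (fun u hu v hv => w3 u hu v hv (all u) (all v))
      omega
    · exact lower_empty K P m n a0 b0 ak bk ha0 hak ham hb0 hbk hbn hP' _ hd
  · have ct := count_shape P _ m n a0 b0 ak bk h1 h2 ha0 hak ham hb0 hbk hbn hP' S
    have ok := S.ok
    have hd : (((m + n + (ak - a0) + (bk - b0) - 2).toNat : ℕ) : ℤ) =
      m + n + (ak - a0) + (bk - b0) - 2 := by omega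
    refine ⟨(m + n + (ak - a0) + (bk - b0) - 2).toNat, le_antisymm ?_ ?_, by omega⟩
    · apply upper_main K P _ m n a0 b0 ak bk ha0 hak ham hb0 hbk hbn hP' ok
      intro W w1 w2 w3 w4
      have := upper_count (QA (parCells S1 S2)) (QB (parCells S1 S2)) m n a0 b0 ak bk
        ha0 hak ham hb0 hbk hbn ?_ ?_ (S.AB hak) ?_ ?_ W w1 w2 w3 w4
      · omega
      · intro x y q1 q2
        constructor
        · intro u v hh hu
          have := ok.box _ _ hh
          simp only at hu ⊢
          omega
        · intro u v hh hu
          have := ok.box _ _ hh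
          simp only at hu ⊢
          omega
      · intro x y q1 q2
        constructor
        · intro u v hh hu
          have := ok.box _ _ hh
          simp only at hu ⊢
          omega
        · intro u v hh hu
          have := ok.box _ _ hh
          simp only at hu ⊢
          omega
      · intro x y q
        simp only [QB, not_forall] at q
        obtain ⟨u, v, hh, q1, q2⟩ := q
        have := ok.box _ _ hh
        omega
      · intro x y q
        simp only [QA, not_forall] at q
        obtain ⟨u, v, hh, q1, q2⟩ := q
        have := ok.box _ _ hh
        omega
    · exact lower_shape K P _ m n a0 b0 ak bk ha0 hak ham hb0 hbk hbn hP' ok (S.AB hak)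
        (S.corner hak) _ hd
end

section
/- Let P be a frame polyomino and Δ(P) the simplicial complex attached to in_<(I_P). Let F be a facet of Δ(P). Then every maximal horizontal edge interval and every maximal vertical edge interval of P contains a vertex belonging to F. -/
/-- All cells of the box are in `C`. -/
noncomputable def boxIn (C : ℤ → ℤ → Prop) (x y x' y' : ℤ) : Prop :=
  ∀ s t, x ≤ s → s < x' → y ≤ t → t < y' → C s t

/-- One rewriting step on multisets of points. -/
noncomputable def RwStep (C : ℤ → ℤ → Prop) (M M' : Multiset (ℤ × ℤ)) : Prop :=
  ∃ x y x' y' r, x < x' ∧ y < y' ∧ boxIn C x y x' y' ∧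
    M = (x, y') ::ₘ (x', y) ::ₘ r ∧ M' = (x, y) ::ₘ (x', y') ::ₘ r

/-- Confluence hypothesis on the cells. -/
noncomputable def ConfHyp (C : ℤ → ℤ → Prop) : Prop :=
  ∀ p q r s t u : ℤ, p < q → q < r → s < t → t < u →
    boxIn C p t q u → boxIn C q s r t → boxIn C p s q t ∨ boxIn C q t r u

/-- Joinability. -/
noncomputable def JoinR (C : ℤ → ℤ → Prop) (A B : Multiset (ℤ × ℤ)) : Prop :=
  ∃ w, Relation.ReflTransGen (RwStep C) A w ∧ Relation.ReflTransGen (RwStep C) B w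

theorem JoinR.symm {C : ℤ → ℤ → Prop} {A B : Multiset (ℤ × ℤ)} (h : JoinR C A B) :
    JoinR C B A := by
  obtain ⟨w, h1, h2⟩ := h
  exact ⟨w, h2, h1⟩

theorem boxIn.mono {C : ℤ → ℤ → Prop} {x y x' y' X Y X' Y' : ℤ} (h : boxIn C x y x' y')
    (h1 : x ≤ X) (h2 : y ≤ Y) (h3 : X' ≤ x') (h4 : Y' ≤ y') : boxIn C X Y X' Y' :=
  fun s t a b c d => h s t (by omega) (by omega) (by omega) (by omega)

theorem RwStep.mk' {C : ℤ → ℤ → Prop} {A B : Multiset (ℤ × ℤ)} (x y x' y' : ℤ)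
    (r : Multiset (ℤ × ℤ)) (hx : x < x') (hy : y < y') (hb : boxIn C x y x' y')
    (hA : A = (x, y') ::ₘ (x', y) ::ₘ r) (hB : B = (x, y) ::ₘ (x', y') ::ₘ r) :
    Relation.ReflTransGen (RwStep C) A B :=
  Relation.ReflTransGen.single ⟨x, y, x', y', r, hx, hy, hb, hA, hB⟩

theorem join_UL {C : ℤ → ℤ → Prop} {x y x' y' X' Y : ℤ} {s : Multiset (ℤ × ℤ)}
    (hx : x < x') (hy : y < y') (hb : boxIn C x y x' y') (hX : x < X') (hY : Y < y')
    (hB : boxIn C x Y X' y') (hle : x' ≤ X') :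
    JoinR C ((x, y) ::ₘ (x', y') ::ₘ (X', Y) ::ₘ s) ((x, Y) ::ₘ (X', y') ::ₘ (x', y) ::ₘ s) := by
  have key : JoinR C ((x, y) ::ₘ (x', Y) ::ₘ (X', y') ::ₘ s)
      ((x, Y) ::ₘ (X', y') ::ₘ (x', y) ::ₘ s) := by
    rcases lt_trichotomy y Y with h | h | h
    · refine ⟨_, .refl, RwStep.mk' x y x' Y ((X', y') ::ₘ s) hx h
        (hb.mono le_rfl le_rfl le_rfl hY.le) ?_ ?_⟩ <;>
      (simp only [← Multiset.singleton_add]; try abel)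
    · subst h
      refine ⟨_, .refl, ?_⟩
      rw [Multiset.cons_swap (x', y)]
    · refine ⟨_, RwStep.mk' x Y x' y ((X', y') ::ₘ s) hx h
        (hB.mono le_rfl le_rfl hle hy.le) ?_ ?_, .refl⟩ <;>
      (simp only [← Multiset.singleton_add]; try abel)
  rcases hle.lt_or_eq with h | h
  · obtain ⟨w, h1, h2⟩ := key
    refine ⟨w, .trans (RwStep.mk' x' Y X' y' ((x, y) ::ₘ s) h hY
      (hB.mono hx.le le_rfl le_rfl le_rfl) ?_ ?_) h1, h2⟩ <;>
      (simp only [← Multiset.singleton_add]; abel)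
  · subst h
    rw [Multiset.cons_swap (x', y')]
    exact key

theorem join_LR {C : ℤ → ℤ → Prop} {x y x' y' X Y' : ℤ} {s : Multiset (ℤ × ℤ)}
    (hx : x < x') (hy : y < y') (hb : boxIn C x y x' y') (hX : X < x') (hY : y < Y')
    (hB : boxIn C X y x' Y') (hle : X ≤ x) :
    JoinR C ((x, y) ::ₘ (x', y') ::ₘ (X, Y') ::ₘ s) ((X, y) ::ₘ (x', Y') ::ₘ (x, y') ::ₘ s) := by
  have key : JoinR C ((x', y') ::ₘ (x, Y') ::ₘ (X, y) ::ₘ s)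
      ((X, y) ::ₘ (x', Y') ::ₘ (x, y') ::ₘ s) := by
    rcases lt_trichotomy y' Y' with h | h | h
    · refine ⟨_, RwStep.mk' x y' x' Y' ((X, y) ::ₘ s) hx h
        (hB.mono hle hy.le le_rfl le_rfl) ?_ ?_, .refl⟩ <;>
      (simp only [← Multiset.singleton_add]; try abel)
    · subst h
      refine ⟨_, .refl, ?_⟩
      have : (X, y) ::ₘ (x', y') ::ₘ (x, y') ::ₘ s = (x', y') ::ₘ (x, y') ::ₘ (X, y) ::ₘ s := by
        simp only [← Multiset.singleton_add]; abel
      rw [this]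
    · refine ⟨_, .refl, RwStep.mk' x Y' x' y' ((X, y) ::ₘ s) hx h
        (hb.mono le_rfl hY.le le_rfl le_rfl) ?_ ?_⟩ <;>
      (simp only [← Multiset.singleton_add]; try abel)
  rcases hle.lt_or_eq with h | h
  · obtain ⟨w, h1, h2⟩ := key
    refine ⟨w, .trans (RwStep.mk' X y x Y' ((x', y') ::ₘ s) h hY
      (hB.mono le_rfl le_rfl hx.le le_rfl) ?_ ?_) h1, h2⟩ <;>
      (simp only [← Multiset.singleton_add]; abel)
  · subst h
    have : (X, y) ::ₘ (x', y') ::ₘ (X, Y') ::ₘ s = (x', y') ::ₘ (X, Y') ::ₘ (X, y) ::ₘ s := by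
      simp only [← Multiset.singleton_add]; abel
    rw [this]
    exact key

/-- `(p,u)`, `(q,t)`, `(r,s)` is a descending staircase. -/
theorem join_mid {C : ℤ → ℤ → Prop} (hC : ConfHyp C) {p q r s t u : ℤ} {m : Multiset (ℤ × ℤ)}
    (h1 : p < q) (h2 : q < r) (h3 : s < t) (h4 : t < u)
    (hb : boxIn C p t q u) (hB : boxIn C q s r t) :
    JoinR C ((p, t) ::ₘ (q, u) ::ₘ (r, s) ::ₘ m) ((q, s) ::ₘ (r, t) ::ₘ (p, u) ::ₘ m) := by
  rcases hC p q r s t u h1 h2 h3 h4 hb hB with h | h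
  · refine ⟨(p, s) ::ₘ (q, u) ::ₘ (r, t) ::ₘ m,
      RwStep.mk' p s r t ((q, u) ::ₘ m) (by omega) h3 ?_ ?_ ?_,
      RwStep.mk' p s q u ((r, t) ::ₘ m) h1 (by omega) ?_ ?_ ?_⟩
    · intro a b _ _ _ _
      by_cases ha : a < q
      · exact h a b ‹_› ha ‹_› ‹_›
      · exact hB a b (by omega) ‹_› ‹_› ‹_›
    · simp only [← Multiset.singleton_add]; abel
    · simp only [← Multiset.singleton_add]; abel
    · intro a b _ _ _ _
      by_cases hb' : b < t
      · exact h a b ‹_› ‹_› ‹_› ‹_›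
      · exact hb a b ‹_› ‹_› (by omega) ‹_›
    · simp only [← Multiset.singleton_add]; abel
    · simp only [← Multiset.singleton_add]; try abel
  · refine ⟨(p, t) ::ₘ (q, s) ::ₘ (r, u) ::ₘ m,
      RwStep.mk' q s r u ((p, t) ::ₘ m) h2 (by omega) ?_ ?_ ?_,
      RwStep.mk' p t r u ((q, s) ::ₘ m) (by omega) h4 ?_ ?_ ?_⟩
    · intro a b _ _ _ _
      by_cases hb' : b < t
      · exact hB a b ‹_› ‹_› ‹_› ‹_›
      · exact h a b ‹_› ‹_› (by omega) ‹_›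
    · simp only [← Multiset.singleton_add]; abel
    · simp only [← Multiset.singleton_add]; abel
    · intro a b _ _ _ _
      by_cases ha : a < q
      · exact hb a b ‹_› ha ‹_› ‹_›
      · exact h a b (by omega) ‹_› ‹_› ‹_›
    · simp only [← Multiset.singleton_add]; abel
    · simp only [← Multiset.singleton_add]; abel

theorem local_confl {C : ℤ → ℤ → Prop} (hC : ConfHyp C) {M A B : Multiset (ℤ × ℤ)}
    (hA : RwStep C M A) (hB : RwStep C M B) : JoinR C A B := by
  obtain ⟨x, y, x', y', r, hx, hy, hb, rfl, rfl⟩ := hA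
  obtain ⟨X, Y, X', Y', r', hX, hY, hb', hM, rfl⟩ := hB
  rw [Multiset.cons_eq_cons] at hM
  rcases hM with ⟨h1, h2⟩ | ⟨h1, cs, h2, h3⟩
  · obtain ⟨rfl, rfl⟩ := Prod.mk.inj h1
    rw [Multiset.cons_eq_cons] at h2
    rcases h2 with ⟨h2, rfl⟩ | ⟨h2, s, rfl, rfl⟩
    · obtain ⟨rfl, rfl⟩ := Prod.mk.inj h2
      exact ⟨_, .refl, .refl⟩
    · rcases le_total x' X' with h | h
      · exact join_UL hx hy hb hX hY hb' h
      · exact (join_UL hX hY hb' hx hy hb h).symm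
  · rw [Multiset.cons_eq_cons] at h2 h3
    rcases h2 with ⟨h2, rfl⟩ | ⟨h2, t, rfl, rfl⟩
    · obtain ⟨rfl, rfl⟩ := Prod.mk.inj h2
      rcases h3 with ⟨h3, h4⟩ | ⟨h3, t, rfl, rfl⟩
      · have := (Prod.mk.inj h3).1
        omega
      · exact join_mid hC hx hX hY hy hb hb'
    · rcases h3 with ⟨h3, rfl⟩ | ⟨h3, v, rfl, h4⟩
      · obtain ⟨rfl, rfl⟩ := Prod.mk.inj h3
        exact (join_mid hC hX hx hy hY hb' hb).symm
      · rw [Multiset.cons_eq_cons] at h4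
        rcases h4 with ⟨h4, rfl⟩ | ⟨h4, w, rfl, rfl⟩
        · obtain ⟨rfl, rfl⟩ := Prod.mk.inj h4
          rcases le_total X x with h | h
          · exact join_LR hx hy hb hX hY hb' h
          · exact (join_LR hX hY hb' hx hy hb h).symm
        · refine ⟨(x, y) ::ₘ (x', y') ::ₘ (X, Y) ::ₘ (X', Y') ::ₘ w,
            RwStep.mk' X Y X' Y' ((x, y) ::ₘ (x', y') ::ₘ w) hX hY hb' ?_ ?_,
            RwStep.mk' x y x' y' ((X, Y) ::ₘ (X', Y') ::ₘ w) hx hy hb ?_ ?_⟩ <;>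
          (simp only [← Multiset.singleton_add]; try abel)

/-- Termination measure. -/
noncomputable def msz (M : Multiset (ℤ × ℤ)) : ℕ := (M.map fun p => ((p.1 - p.2) ^ 2).toNat).sum

theorem msz_lt {C : ℤ → ℤ → Prop} {M M' : Multiset (ℤ × ℤ)} (h : RwStep C M M') :
    msz M' < msz M := by
  obtain ⟨x, y, x', y', r, hx, hy, hb, rfl, rfl⟩ := h
  simp only [msz, Multiset.map_cons, Multiset.sum_cons]
  have h1 := Int.toNat_of_nonneg (sq_nonneg (x - y))
  have h2 := Int.toNat_of_nonneg (sq_nonneg (x' - y'))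
  have h3 := Int.toNat_of_nonneg (sq_nonneg (x - y'))
  have h4 := Int.toNat_of_nonneg (sq_nonneg (x' - y))
  have h5 : (x - y) ^ 2 + (x' - y') ^ 2 < (x - y') ^ 2 + (x' - y) ^ 2 := by
    nlinarith [mul_pos (sub_pos.2 hx) (sub_pos.2 hy)]
  omega

theorem reach_step {C : ℤ → ℤ → Prop} (hC : ConfHyp C) {m : Multiset (ℤ × ℤ)}
    (hm : ∀ m', ¬ RwStep C m m') : ∀ (k : ℕ) (u u' : Multiset (ℤ × ℤ)), msz u ≤ k →
    Relation.ReflTransGen (RwStep C) u m → RwStep C u u' →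
    Relation.ReflTransGen (RwStep C) u' m := by
  intro k
  induction k with
  | zero =>
    intro u u' hk _ h
    have := msz_lt h
    omega
  | succ k ih =>
    intro u u' hk hu h
    rcases Relation.ReflTransGen.cases_head hu with rfl | ⟨u1, h1, h2⟩
    · exact absurd h (hm _)
    · obtain ⟨w, hw1, hw2⟩ := local_confl hC h1 h
      have aux : msz w ≤ k ∧ Relation.ReflTransGen (RwStep C) w m := by
        clear hw2
        induction hw1 with
        | refl => exact ⟨by have := msz_lt h1; omega, h2⟩
        | tail _ hbc ihw =>
          exact ⟨by have := msz_lt hbc; omega, ih _ _ ihw.1 ihw.2 hbc⟩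
      exact hw2.trans aux.2

theorem reach_iff {C : ℤ → ℤ → Prop} (hC : ConfHyp C) {m : Multiset (ℤ × ℤ)}
    (hm : ∀ m', ¬ RwStep C m m') {u u' : Multiset (ℤ × ℤ)} (h : RwStep C u u') :
    Relation.ReflTransGen (RwStep C) u m ↔ Relation.ReflTransGen (RwStep C) u' m :=
  ⟨fun h' => reach_step hC hm _ u u' le_rfl h' h, fun h' => .head h h'⟩

/-- The first blocked/unblocked combinatorial lemma. -/
theorem exists_free_point {C : ℤ → ℤ → Prop} {m n : ℤ}
    (hrect : ∀ s t, C s t → 1 ≤ s ∧ s < m ∧ 1 ≤ t ∧ t < n)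
    (hrow : ∀ x1 y1 x2 y2 j, (1 ≤ x1 ∧ x1 < m ∧ 1 ≤ y1 ∧ y1 < n) →
      (1 ≤ x2 ∧ x2 < m ∧ 1 ≤ y2 ∧ y2 < n) → ¬ C x1 y1 → ¬ C x2 y2 → y2 < j → j ≤ y1 →
      ∃ x, min x1 x2 ≤ x ∧ x ≤ max x1 x2 ∧ ¬ C x (j - 1) ∧ ¬ C x j)
    {G : ℤ → ℤ → Prop}
    (hG : ∀ x y x' y', x < x' → y < y' → boxIn C x y x' y' → G x y' → G x' y → False)
    {i k j : ℤ} (hik : i < k) (hM : ∀ l, i ≤ l → l < k → C l j ∨ C l (j - 1))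
    (hi : ¬ (C (i - 1) j ∨ C (i - 1) (j - 1))) (hk : ¬ (C k j ∨ C k (j - 1))) :
    ∃ v, i ≤ v ∧ v ≤ k ∧
      (∀ x' y, v < x' → y < j → boxIn C v y x' j → ¬ G x' y) ∧
      (∀ x y', x < v → j < y' → boxIn C x j v y' → ¬ G x y') := by
  by_contra hcon
  push Not at hcon
  let A : ℤ → Prop := fun v => ∃ x' y, v < x' ∧ y < j ∧ boxIn C v y x' j ∧ G x' y
  let B : ℤ → Prop := fun v => ∃ x y', x < v ∧ j < y' ∧ boxIn C x j v y' ∧ G x y'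
  have hAB : ∀ v, i ≤ v → v ≤ k → A v ∨ B v := by
    intro v h1 h2
    by_cases hA : A v
    · exact Or.inl hA
    · right
      obtain ⟨x, y', q⟩ := hcon v h1 h2 (fun x' y a b c d => hA ⟨x', y, a, b, c, d⟩)
      exact ⟨x, y', q⟩
  -- intervals meeting the edge interval stay inside
  have hright : ∀ v x' y, i ≤ v → v ≤ k → y < j → boxIn C v y x' j → x' ≤ k := by
    intro v x' y _ _ _ hb
    by_contra hlt
    exact hk (Or.inr (hb k (j - 1) (by omega) (by omega) (by omega) (by omega)))
  have hleft : ∀ v x y', i ≤ v → v ≤ k → j < y' → boxIn C x j v y' → i ≤ x := by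
    intro v x y' _ _ _ hb
    by_contra hlt
    exact hi (Or.inl (hb (i - 1) j (by omega) (by omega) (by omega) (by omega)))
  have hBi : ¬ B i := by
    rintro ⟨x, y', h1, h2, h3, -⟩
    have := hleft i x y' le_rfl hik.le h2 h3
    omega
  have hAk : ¬ A k := by
    rintro ⟨x', y, h1, h2, h3, -⟩
    have := hright k x' y hik.le le_rfl h2 h3
    omega
  have hBk : B k := (hAB k hik.le le_rfl).resolve_left hAk
  have hAi : A i := (hAB i le_rfl hik.le).resolve_right hBi
  -- first element of B
  obtain ⟨v, ⟨hvi, hvk, hvB⟩, hvmin⟩ := Int.exists_least_of_bdd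
    (P := fun v => i ≤ v ∧ v ≤ k ∧ B v) ⟨i, fun z hz => hz.1⟩ ⟨k, hik.le, le_rfl, hBk⟩
  obtain ⟨p, u, hp, hu, hpu, hGpu⟩ := hvB
  have hip := hleft v p u hvi hvk hu hpu
  have hAp : A p := (hAB p hip (by omega)).resolve_right
    (fun h => by have := hvmin p ⟨hip, by omega, h⟩; omega)
  obtain ⟨r, s, hpr, hs, hrs, hGrs⟩ := hAp
  have hrk := hright p r s hip (by omega) hs hrs
  -- the hole meets the upper right box
  have hole1 : ∃ x1 y1, p ≤ x1 ∧ x1 < r ∧ j ≤ y1 ∧ y1 < u ∧ ¬ C x1 y1 := by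
    by_contra hno
    push Not at hno
    refine hG p s r u hpr (by omega) ?_ hGpu hGrs
    intro a b h1 h2 h3 h4
    by_cases hb : b < j
    · exact hrs a b h1 h2 h3 hb
    · exact hno a b h1 h2 (by omega) h4
  -- last element of A
  obtain ⟨v2, ⟨hv2i, hv2k, hv2A⟩, hv2max⟩ := Int.exists_greatest_of_bdd
    (P := fun v => i ≤ v ∧ v ≤ k ∧ A v) ⟨k, fun z hz => hz.2.1⟩ ⟨i, le_rfl, hik.le, hAi⟩
  obtain ⟨r2, s2, hr2, hs2, hrs2, hGrs2⟩ := hv2A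
  have hr2k := hright v2 r2 s2 hv2i hv2k hs2 hrs2
  have hBr2 : B r2 := (hAB r2 (by omega) hr2k).resolve_left
    (fun h => by have := hv2max r2 ⟨by omega, hr2k, h⟩; omega)
  obtain ⟨p2, u2, hp2, hu2, hpu2, hGpu2⟩ := hBr2
  have hip2 := hleft r2 p2 u2 (by omega) hr2k hu2 hpu2
  have hole2 : ∃ x2 y2, p2 ≤ x2 ∧ x2 < r2 ∧ s2 ≤ y2 ∧ y2 < j ∧ ¬ C x2 y2 := by
    by_contra hno
    push Not at hno
    refine hG p2 s2 r2 u2 hp2 (by omega) ?_ hGpu2 hGrs2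
    intro a b h1 h2 h3 h4
    by_cases hb : b < j
    · exact hno a b h1 h2 h3 hb
    · exact hpu2 a b h1 h2 (by omega) h4
  obtain ⟨x1, y1, a1, a2, a3, a4, hx1⟩ := hole1
  obtain ⟨x2, y2, b1, b2, b3, b4, hx2⟩ := hole2
  have R1 := hrect p (u - 1) (hpu p (u - 1) le_rfl hp (by omega) (by omega))
  have R2 := hrect (r - 1) s (hrs (r - 1) s (by omega) (by omega) le_rfl hs)
  have R3 := hrect p2 j (hpu2 p2 j le_rfl hp2 le_rfl hu2)
  have R4 := hrect (r2 - 1) s2 (hrs2 (r2 - 1) s2 (by omega) (by omega) le_rfl hs2)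
  obtain ⟨x, c1, c2, c3, c4⟩ := hrow x1 y1 x2 y2 j (by omega) (by omega) hx1 hx2 b4 a3
  rcases hM x (by omega) (by omega) with h | h
  · exact c4 h
  · exact c3 h

theorem conf_of_row {C : ℤ → ℤ → Prop} {m n : ℤ}
    (hrect : ∀ s t, C s t → 1 ≤ s ∧ s < m ∧ 1 ≤ t ∧ t < n)
    (hrow : ∀ x1 y1 x2 y2 j, (1 ≤ x1 ∧ x1 < m ∧ 1 ≤ y1 ∧ y1 < n) →
      (1 ≤ x2 ∧ x2 < m ∧ 1 ≤ y2 ∧ y2 < n) → ¬ C x1 y1 → ¬ C x2 y2 → y2 < j → j ≤ y1 →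
      ∃ x, min x1 x2 ≤ x ∧ x ≤ max x1 x2 ∧ ¬ C x (j - 1) ∧ ¬ C x j) : ConfHyp C := by
  intro p q r s t u h1 h2 h3 h4 hb hB
  by_contra hcon
  simp only [boxIn, not_or] at hcon
  push Not at hcon
  obtain ⟨⟨x2, y2, a1, a2, a3, a4, hx2⟩, ⟨x1, y1, b1, b2, b3, b4, hx1⟩⟩ := hcon
  have R1 := hrect p (u - 1) (hb p (u - 1) le_rfl h1 (by omega) (by omega))
  have R2 := hrect (r - 1) s (hB (r - 1) s (by omega) (by omega) le_rfl h3)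
  obtain ⟨x, c1, c2, c3, c4⟩ := hrow x1 y1 x2 y2 t (by omega) (by omega) hx1 hx2 a4 b3
  by_cases hx : x < q
  · exact c4 (hb x t (by omega) hx le_rfl h4)
  · exact c3 (hB x (t - 1) (by omega) (by omega) (by omega) (by omega))

theorem ne_pairwise {L : List (ℤ × ℤ)} (h : IsNEPath L) : L.Pairwise (· ≤ ·) := by
  have h2 : L.IsChain (· ≤ ·) := by
    refine List.IsChain.imp ?_ h.2
    rintro u v (rfl | rfl)
    · exact Prod.mk_le_mk.2 ⟨by omega, le_rfl⟩
    · exact Prod.mk_le_mk.2 ⟨le_rfl, by omega⟩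
  exact List.isChain_iff_pairwise.1 h2

theorem ne_total {L : List (ℤ × ℤ)} (h : IsNEPath L) {p q : ℤ × ℤ} (hp : p ∈ L) (hq : q ∈ L) :
    p ≤ q ∨ q ≤ p := by
  obtain ⟨i, hi, rfl⟩ := List.mem_iff_getElem.1 hp
  obtain ⟨j, hj, rfl⟩ := List.mem_iff_getElem.1 hq
  have hpw := List.pairwise_iff_getElem.1 (ne_pairwise h)
  rcases lt_trichotomy i j with hij | rfl | hij
  · exact Or.inl (hpw i j hi hj hij)
  · exact Or.inl le_rfl
  · exact Or.inr (hpw j i hj hi hij)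

theorem east_mem {L : List (ℤ × ℤ)} {x h : ℤ} (he : eastStepOf L x h) :
    (x, h) ∈ L ∧ (x + 1, h) ∈ L := by
  have := List.of_mem_zip he
  exact ⟨this.1, List.mem_of_mem_tail this.2⟩

theorem east_mono {L : List (ℤ × ℤ)} (hL : IsNEPath L) {x h x' h' : ℤ} (he : eastStepOf L x h)
    (he' : eastStepOf L x' h') (hx : x ≤ x') : h ≤ h' := by
  rcases ne_total hL (east_mem he).1 (east_mem he').2 with h1 | h1
  · exact h1.2
  · have := h1.1
    simp only at this
    omega

theorem east_exists {L : List (ℤ × ℤ)} (hL : IsNEPath L) {p q : ℤ × ℤ} (hp : L.head? = some p)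
    (hq : L.getLast? = some q) {x : ℤ} (h1 : p.1 ≤ x) (h2 : x < q.1) : ∃ h, eastStepOf L x h := by
  induction L generalizing p with
  | nil => simp at hp
  | cons a t ih =>
    cases t with
    | nil =>
      simp at hp hq
      subst hp hq
      omega
    | cons b t =>
      simp at hp
      subst hp
      have hc := hL.2
      have hc' : (b = (a.1 + 1, a.2) ∨ b = (a.1, a.2 + 1)) ∧
        (b :: t).IsChain (fun u v : ℤ × ℤ => v = (u.1 + 1, u.2) ∨ v = (u.1, u.2 + 1)) :=
        List.isChain_cons_cons.1 hc
      have ih' : b.1 ≤ x → ∃ h, eastStepOf (a :: b :: t) x h := by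
        intro hb
        obtain ⟨h, hh⟩ := ih (p := b) ⟨by simp, hc'.2⟩ (by simp) (by simpa using hq) hb
        refine ⟨h, ?_⟩
        unfold eastStepOf at hh ⊢
        exact List.mem_cons_of_mem _ hh
      rcases hc'.1 with hb | hb
      · rcases h1.lt_or_eq with h | h
        · exact ih' (by rw [hb]; simp only; omega)
        · refine ⟨a.2, ?_⟩
          unfold eastStepOf
          subst h
          rw [← hb]
          simp
      · exact ih' (by rw [hb]; exact h1)

theorem east_bounds {L : List (ℤ × ℤ)} (hL : IsNEPath L) {p q : ℤ × ℤ} (hp : L.head? = some p)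
    (hq : L.getLast? = some q) {x h : ℤ} (he : eastStepOf L x h) : p.1 ≤ x ∧ x < q.1 := by
  have hm := east_mem he
  have hpw := ne_pairwise hL
  constructor
  · cases L with
    | nil => simp at hp
    | cons a t =>
      simp at hp
      subst hp
      rcases List.mem_cons.1 hm.1 with h1 | h1
      · rw [← h1]
      · exact ((List.pairwise_cons.1 hpw).1 _ h1).1
  · have : (x + 1, h) ≤ q := by
      obtain ⟨l, rfl⟩ := List.getLast?_eq_some_iff.1 hq
      rw [List.pairwise_append] at hpw
      rcases List.mem_append.1 hm.2 with h1 | h1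
      · exact hpw.2.2 _ h1 _ (by simp)
      · simp at h1
        exact h1.le
    have := this.1
    simp only at this
    omega

theorem mem_interiorPts {L : List (ℤ × ℤ)} {p q v : ℤ × ℤ} (hp : L.head? = some p)
    (hq : L.getLast? = some q) (hv : v ∈ L) (h1 : v ≠ p) (h2 : v ≠ q) : v ∈ interiorPts L := by
  unfold interiorPts
  cases L with
  | nil => simp at hp
  | cons a t =>
    simp at hp
    subst hp
    have hvt : v ∈ t := (List.mem_cons.1 hv).resolve_left h1
    rcases List.eq_nil_or_concat t with rfl | ⟨l, b, rfl⟩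
    · simp at hvt
    · have : b = q := by
        have h3 : (a :: (l ++ [b])).getLast? = some b := by
          rw [← List.cons_append, List.getLast?_concat]
        simpa [h3] using hq
      subst this
      simp at hvt ⊢
      exact hvt.resolve_right h2

theorem hole_adj (D : FrameData) {x h h' : ℤ} (h1 : eastStepOf D.S1 x h)
    (h2 : eastStepOf D.S2 (x + 1) h') : h' < h := by
  have hd := D.par.headEq ▸ D.head1
  have hl := D.par.lastEq ▸ D.last1
  have b1 := (east_bounds D.par.ne1 D.head1 D.last1 h1).1
  have b2 := (east_bounds D.par.ne2 hd hl h2).2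
  simp only at b1 b2
  refine D.par.above (x + 1, h) (mem_interiorPts D.head1 D.last1 (east_mem h1).2 ?_ ?_)
    (x + 1, h') (mem_interiorPts hd hl (east_mem h2).1 ?_ ?_) rfl <;>
  · intro hh
    have := congrArg Prod.fst hh
    simp only at this
    omega

theorem hole_iff (D : FrameData) (x y : ℤ) : (x, y) ∈ D.holeCells ↔
    ∃ h h', eastStepOf D.S1 x h ∧ eastStepOf D.S2 x h' ∧ h' ≤ y ∧ y < h := by
  constructor
  · rintro ⟨⟨h, a, b⟩, ⟨h', a', b'⟩⟩
    exact ⟨h, h', a, a', b', b⟩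
  · rintro ⟨h, h', a, a', b', b⟩
    exact ⟨⟨h, a, b⟩, ⟨h', a', b'⟩⟩

theorem hole_cols (D : FrameData) {x1 x2 x h h' : ℤ} (e1 : eastStepOf D.S1 x1 h)
    (e2 : eastStepOf D.S1 x2 h') (h1 : x1 ≤ x) (h2 : x ≤ x2) :
    (∃ g, eastStepOf D.S1 x g) ∧ ∃ g, eastStepOf D.S2 x g := by
  have hd := D.par.headEq ▸ D.head1
  have hl := D.par.lastEq ▸ D.last1
  have b1 := (east_bounds D.par.ne1 D.head1 D.last1 e1).1
  have b2 := (east_bounds D.par.ne1 D.head1 D.last1 e2).2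
  exact ⟨east_exists D.par.ne1 D.head1 D.last1 (b1.trans h1) (by omega),
    east_exists D.par.ne2 hd hl (b1.trans h1) (by omega)⟩

theorem hole_row (D : FrameData) {x1 y1 x2 y2 j : ℤ} (H1 : (x1, y1) ∈ D.holeCells)
    (H2 : (x2, y2) ∈ D.holeCells) (hj2 : y2 < j) (hj1 : j ≤ y1) :
    ∃ x, min x1 x2 ≤ x ∧ x ≤ max x1 x2 ∧ (x, j - 1) ∈ D.holeCells ∧ (x, j) ∈ D.holeCells := by
  simp only [hole_iff] at *
  obtain ⟨u1, l1, eu1, el1, c1, d1⟩ := H1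
  obtain ⟨u2, l2, eu2, el2, c2, d2⟩ := H2
  rcases le_total x2 x1 with hle | hle
  · obtain ⟨x, ⟨hx2, u, eu, hu⟩, hmin⟩ := Int.exists_least_of_bdd
      (P := fun x => x2 ≤ x ∧ ∃ u, eastStepOf D.S1 x u ∧ j + 1 ≤ u) ⟨x2, fun z hz => hz.1⟩
      ⟨x1, hle, u1, eu1, by omega⟩
    have hx1 : x ≤ x1 := hmin x1 ⟨hle, u1, eu1, by omega⟩
    obtain ⟨-, l, el⟩ := hole_cols D eu2 eu1 hx2 hx1
    have hl : l < j := by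
      rcases hx2.lt_or_eq with h | h
      · obtain ⟨⟨u', eu'⟩, -⟩ := hole_cols D (x := x - 1) eu2 eu1 (by omega) (by omega)
        have hu' : u' ≤ j := by
          by_contra hc
          have := hmin (x - 1) ⟨by omega, u', eu', by omega⟩
          omega
        have := hole_adj D eu' (h' := l) (by simpa using el)
        omega
      · subst h
        have := east_mono D.par.ne2 el el2 le_rfl
        omega
    exact ⟨x, by omega, by omega, ⟨u, l, eu, el, by omega, by omega⟩,
      ⟨u, l, eu, el, by omega, by omega⟩⟩
  · have := east_mono D.par.ne2 el1 el2 hle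
    exact ⟨x1, by omega, by omega, ⟨u1, l1, eu1, el1, by omega, by omega⟩,
      ⟨u1, l1, eu1, el1, by omega, by omega⟩⟩

theorem hole_col (D : FrameData) {x1 y1 x2 y2 i : ℤ} (H1 : (x1, y1) ∈ D.holeCells)
    (H2 : (x2, y2) ∈ D.holeCells) (hj2 : x2 < i) (hj1 : i ≤ x1) :
    ∃ y, min y1 y2 ≤ y ∧ y ≤ max y1 y2 ∧ (i - 1, y) ∈ D.holeCells ∧ (i, y) ∈ D.holeCells := by
  simp only [hole_iff] at *
  obtain ⟨u1, l1, eu1, el1, c1, d1⟩ := H1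
  obtain ⟨u2, l2, eu2, el2, c2, d2⟩ := H2
  obtain ⟨⟨u, eu⟩, l, el⟩ := hole_cols D (x := i) eu2 eu1 (by omega) (by omega)
  obtain ⟨⟨u', eu'⟩, l', el'⟩ := hole_cols D (x := i - 1) eu2 eu1 (by omega) (by omega)
  have m1 := east_mono D.par.ne1 eu' eu (by omega)
  have m2 := east_mono D.par.ne2 el' el (by omega)
  have m3 := hole_adj D eu' (h' := l) (by simpa using el)
  have m4 := east_mono D.par.ne2 el el1 (by omega)
  have m5 := east_mono D.par.ne1 eu2 eu' (by omega)
  refine ⟨max y2 l, by omega, by omega, ⟨u', l', eu', el', by omega, by omega⟩,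
      ⟨u, l, eu, el, by omega, by omega⟩⟩

/-- The cells of `P` as a binary predicate. -/
noncomputable def cellPred (P : Polyomino) (s t : ℤ) : Prop := (s, t) ∈ P.cells

/-- The multiset of points of a monomial. -/
noncomputable def ptsOf {P : Polyomino} (u : PVertex P →₀ ℕ) : Multiset (ℤ × ℤ) :=
  (Finsupp.toMultiset u).map Subtype.val

theorem inner_iff (P : Polyomino) (a b : ℤ × ℤ) : IsInnerInterval P a b ↔
    a.1 < b.1 ∧ a.2 < b.2 ∧ boxIn (cellPred P) a.1 a.2 b.1 b.2 := by
  unfold IsInnerInterval boxIn cellPred cellInInterval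
  constructor
  · rintro ⟨h1, h2, h3⟩
    exact ⟨h1, h2, fun s t _ _ _ _ => h3 (s, t) ⟨by omega, by omega, by omega, by omega⟩⟩
  · rintro ⟨h1, h2, h3⟩
    exact ⟨h1, h2, fun c hc => h3 c.1 c.2 (by omega) (by omega) (by omega) (by omega)⟩

theorem count_ptsOf {P : Polyomino} (u : PVertex P →₀ ℕ) (v : PVertex P) :
    (ptsOf u).count v.1 = u v := by
  classical
  unfold ptsOf
  rw [Multiset.count_map_eq_count' _ _ Subtype.val_injective, Finsupp.count_toMultiset]

theorem mem_ptsOf {P : Polyomino} {u : PVertex P →₀ ℕ} {p : ℤ × ℤ} (h : p ∈ ptsOf u) :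
    p ∈ P.vertexSet := by
  unfold ptsOf at h
  obtain ⟨v, -, rfl⟩ := Multiset.mem_map.1 h
  exact v.2

theorem ptsOf_inj {P : Polyomino} {u v : PVertex P →₀ ℕ} (h : ptsOf u = ptsOf v) : u = v := by
  ext w
  rw [← count_ptsOf, h, count_ptsOf]

theorem ptsOf_add {P : Polyomino} (u v : PVertex P →₀ ℕ) : ptsOf (u + v) = ptsOf u + ptsOf v := by
  simp [ptsOf]

theorem ptsOf_single {P : Polyomino} (v : PVertex P) : ptsOf (Finsupp.single v 1) = {v.1} := by
  simp [ptsOf]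

theorem card_ptsOf {P : Polyomino} (u : PVertex P →₀ ℕ) :
    (ptsOf u).card = u.sum fun _ e => e := by
  simp [ptsOf, Finsupp.card_toMultiset]
  rfl

theorem step_of_minor {P : Polyomino} {a b c d : PVertex P} (h : IsInnerInterval P a.1 b.1)
    (hc : c.1 = (a.1.1, b.1.2)) (hd : d.1 = (b.1.1, a.1.2)) (u : PVertex P →₀ ℕ) :
    RwStep (cellPred P) (ptsOf (u + (Finsupp.single c 1 + Finsupp.single d 1)))
      (ptsOf (u + (Finsupp.single a 1 + Finsupp.single b 1))) := by
  rw [inner_iff] at h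
  refine ⟨a.1.1, a.1.2, b.1.1, b.1.2, ptsOf u, h.1, h.2.1, h.2.2, ?_, ?_⟩
  · simp only [ptsOf_add, ptsOf_single, hc, hd, ← Multiset.singleton_add]
    abel
  · simp only [ptsOf_add, ptsOf_single, ← Multiset.singleton_add]
    abel

open Classical in
/-- The functional counting the coefficients of monomials reducing to `m`. -/
noncomputable def redFun (K : Type) [Field K] (P : Polyomino) (m : Multiset (ℤ × ℤ)) : PolyRing K P →ₗ[K] K :=
  (MvPolynomial.basisMonomials (PVertex P) K).constr K (fun u =>
    if Relation.ReflTransGen (RwStep (cellPred P)) (ptsOf u) m then (1 : K) else 0)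

open Classical in
theorem redFun_monomial (K : Type) [Field K] (P : Polyomino) (m : Multiset (ℤ × ℤ))
    (u : PVertex P →₀ ℕ) (c : K) : redFun K P m (MvPolynomial.monomial u c) =
    c * if Relation.ReflTransGen (RwStep (cellPred P)) (ptsOf u) m then (1 : K) else 0 := by
  have h1 : (MvPolynomial.monomial u c : PolyRing K P) =
      c • (MvPolynomial.basisMonomials (PVertex P) K) u := by
    simp [MvPolynomial.smul_monomial]
  rw [h1, map_smul, redFun, Module.Basis.constr_basis, smul_eq_mul]

theorem redFun_ideal (K : Type) [Field K] (P : Polyomino) (hC : ConfHyp (cellPred P))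
    {m : Multiset (ℤ × ℤ)} (hm : ∀ m', ¬ RwStep (cellPred P) m m') {f : PolyRing K P}
    (hf : f ∈ polyIdeal K P) : redFun K P m f = 0 := by
  classical
  have key : ∀ g ∈ innerMinors K P, ∀ p : PolyRing K P, redFun K P m (p * g) = 0 := by
    rintro g ⟨a, b, c, d, hin, hc, hd, rfl⟩ p
    induction p using MvPolynomial.induction_on' with
    | monomial u t =>
      have e : (MvPolynomial.monomial u t : PolyRing K P) *
          (MvPolynomial.X a * MvPolynomial.X b - MvPolynomial.X c * MvPolynomial.X d) =
          MvPolynomial.monomial (u + (Finsupp.single a 1 + Finsupp.single b 1)) t -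
          MvPolynomial.monomial (u + (Finsupp.single c 1 + Finsupp.single d 1)) t := by
        simp only [MvPolynomial.X, MvPolynomial.monomial_mul, mul_sub, mul_one]
      rw [e, map_sub, redFun_monomial, redFun_monomial]
      rw [if_congr (reach_iff hC hm (step_of_minor hin hc hd u)) rfl rfl, sub_self]
    | add p q hp hq => rw [add_mul, map_add, hp, hq, add_zero]
  unfold polyIdeal at hf
  induction hf using Submodule.span_induction with
  | mem x h => simpa using key x h 1
  | zero => simp
  | add x y _ _ hx hy => rw [map_add, hx, hy, add_zero]
  | smul a x hx _ =>
    clear * - hx key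
    induction hx using Submodule.span_induction generalizing a with
    | mem x h => exact key x h a
    | zero => simp
    | add x y _ _ hx hy => rw [smul_add, map_add, hx, hy, add_zero]
    | smul b x _ h => rw [smul_smul]; exact h _

theorem varlt_trans {u v w : ℤ × ℤ} (h1 : varlt u v) (h2 : varlt v w) : varlt u w := by
  unfold varlt at *
  omega

theorem varlt_tri (u v : ℤ × ℤ) : varlt u v ∨ u = v ∨ varlt v u := by
  unfold varlt
  by_cases h : u = v
  · exact Or.inr (Or.inl h)
  · have : ¬ (u.1 = v.1 ∧ u.2 = v.2) := fun hh => h (Prod.ext hh.1 hh.2)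
    omega

/-- Revlex comparison of multisets of the same size. -/
noncomputable def mlex (A B : Multiset (ℤ × ℤ)) : Prop :=
  ∃ v, A.count v < B.count v ∧ ∀ w, varlt w v → A.count w = B.count w

theorem mlex_trans {A B D : Multiset (ℤ × ℤ)} (h1 : mlex A B) (h2 : mlex B D) : mlex A D := by
  obtain ⟨v, hv, hv'⟩ := h1
  obtain ⟨w, hw, hw'⟩ := h2
  rcases varlt_tri v w with h | rfl | h
  · exact ⟨v, by rw [← hw' v h]; exact hv,
      fun z hz => (hv' z hz).trans (hw' z (varlt_trans hz h))⟩
  · exact ⟨v, hv.trans hw, fun z hz => (hv' z hz).trans (hw' z hz)⟩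
  · exact ⟨w, by rw [hv' w h]; exact hw,
      fun z hz => (hv' z (varlt_trans hz h)).trans (hw' z hz)⟩

theorem mlex_step {C : ℤ → ℤ → Prop} {A B : Multiset (ℤ × ℤ)} (h : RwStep C A B) : mlex A B := by
  obtain ⟨x, y, x', y', r, hx, hy, hb, rfl, rfl⟩ := h
  refine ⟨(x, y), ?_, ?_⟩
  · have h1 : (x, y) ≠ (x, y') := fun h => by have := (Prod.mk.inj h).2; omega
    have h2 : (x, y) ≠ (x', y) := fun h => by have := (Prod.mk.inj h).1; omega
    have h3 : (x, y) ≠ (x', y') := fun h => by have := (Prod.mk.inj h).1; omega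
    rw [Multiset.count_cons_of_ne h1, Multiset.count_cons_of_ne h2, Multiset.count_cons_self,
      Multiset.count_cons_of_ne h3]
    omega
  · intro w hw
    unfold varlt at hw
    simp only at hw
    have h0 : w ≠ (x, y) := by rintro rfl; simp only at hw; omega
    have h1 : w ≠ (x, y') := by rintro rfl; simp only at hw; omega
    have h2 : w ≠ (x', y) := by rintro rfl; simp only at hw; omega
    have h3 : w ≠ (x', y') := by rintro rfl; simp only at hw; omega
    simp only [Multiset.count_cons_of_ne h0, Multiset.count_cons_of_ne h1,
      Multiset.count_cons_of_ne h2, Multiset.count_cons_of_ne h3]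

theorem reach_card_lex {C : ℤ → ℤ → Prop} {A B : Multiset (ℤ × ℤ)}
    (h : Relation.ReflTransGen (RwStep C) A B) : A.card = B.card ∧ (A = B ∨ mlex A B) := by
  induction h with
  | refl => exact ⟨rfl, Or.inl rfl⟩
  | tail _ hbc ih =>
    refine ⟨ih.1.trans ?_, Or.inr ?_⟩
    · obtain ⟨x, y, x', y', r, hx, hy, hb, rfl, rfl⟩ := hbc
      simp
    · rcases ih.2 with rfl | h
      · exact mlex_step hbc
      · exact mlex_trans h (mlex_step hbc)

theorem not_reach_of_lt {P : Polyomino} {u m : PVertex P →₀ ℕ} (h : pmonLT P u m) :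
    ¬ Relation.ReflTransGen (RwStep (cellPred P)) (ptsOf u) (ptsOf m) := by
  intro hr
  obtain ⟨hc, hl⟩ := reach_card_lex hr
  rw [card_ptsOf, card_ptsOf] at hc
  rcases h with h | ⟨-, v, hv, hv'⟩
  · omega
  rcases hl with hl | ⟨w, hw, hw'⟩
  · rw [ptsOf_inj hl] at hv
    omega
  · have hwm : w ∈ P.vertexSet := mem_ptsOf (u := m) (Multiset.count_pos.1 (by omega))
    rcases varlt_tri v.1 w with h | h | h
    · have := hw' v.1 h
      rw [count_ptsOf, count_ptsOf] at this
      omega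
    · subst h
      rw [count_ptsOf, count_ptsOf] at hw
      omega
    · have := hv' ⟨w, hwm⟩ h
      rw [← count_ptsOf, ← count_ptsOf] at this
      simp only at this
      omega

theorem lead_reducible (K : Type) [Field K] (P : Polyomino) (hC : ConfHyp (cellPred P))
    {f : PolyRing K P} (hf : f ∈ polyIdeal K P) {m : PVertex P →₀ ℕ}
    (hm : IsLeadMon (pmonLT P) f m) : ∃ m', RwStep (cellPred P) (ptsOf m) m' := by
  classical
  by_contra hcon
  push Not at hcon
  have h0 := redFun_ideal K P hC hcon hf
  have h1 : redFun K P (ptsOf m) f = ∑ u ∈ f.support, MvPolynomial.coeff u f *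
      if Relation.ReflTransGen (RwStep (cellPred P)) (ptsOf u) (ptsOf m) then (1 : K) else 0 := by
    conv_lhs => rw [← MvPolynomial.support_sum_monomial_coeff f]
    rw [map_sum]
    exact Finset.sum_congr rfl fun u _ => redFun_monomial K P _ u _
  rw [h1, Finset.sum_eq_single_of_mem m hm.1, if_pos .refl, mul_one] at h0
  · exact MvPolynomial.mem_support_iff.1 hm.1 h0
  · intro u hu hne
    rw [if_neg (not_reach_of_lt (hm.2 u hu hne)), mul_zero]

theorem expOf_apply (P : Polyomino) (W : Finset (ℤ × ℤ)) (v : PVertex P) :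
    expOf P W v = if v.1 ∈ W then 1 else 0 := by
  classical
  unfold expOf
  rw [Finsupp.finset_sum_apply, Finset.sum_eq_single v]
  · split_ifs <;> simp
  · intro b _ hb
    split_ifs
    · simp [Finsupp.single_apply, hb]
    · rfl
  · intro h
    exact absurd (Finset.mem_attach _ v) h

theorem exists_pair_of_mem (K : Type) [Field K] (P : Polyomino) (hC : ConfHyp (cellPred P))
    {W : Finset (ℤ × ℤ)} (h : MvPolynomial.monomial (expOf P W) (1 : K) ∈ inIdeal K P) :
    ∃ x y x' y', x < x' ∧ y < y' ∧ boxIn (cellPred P) x y x' y' ∧ (x, y') ∈ W ∧ (x', y) ∈ W := by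
  classical
  have hle : inIdeal K P ≤ Ideal.span ((fun s => MvPolynomial.monomial s (1 : K)) ''
      {m : PVertex P →₀ ℕ | ∃ m', RwStep (cellPred P) (ptsOf m) m'}) := by
    refine Ideal.span_mono ?_
    rintro g ⟨f, hf, -, m, hm, rfl⟩
    exact ⟨m, lead_reducible K P hC hf hm, rfl⟩
  have h2 := MvPolynomial.mem_ideal_span_monomial_image.1 (hle h) (expOf P W) (by simp)
  obtain ⟨s, ⟨m', x, y, x', y', r, hx, hy, hb, hs, -⟩, hsW⟩ := h2
  have aux : ∀ p ∈ ptsOf s, p ∈ W := by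
    intro p hp
    have h3 := hsW ⟨p, mem_ptsOf hp⟩
    rw [← count_ptsOf, expOf_apply] at h3
    have h4 := Multiset.count_pos.2 hp
    by_contra hpW
    simp only [hpW, if_false] at h3
    omega
  exact ⟨x, y, x', y', hx, hy, hb, aux _ (by rw [hs]; simp), aux _ (by rw [hs]; simp)⟩

theorem cell_vertex {P : Polyomino} {s t : ℤ} (h : cellPred P s t) :
    (s, t) ∈ P.vertexSet ∧ (s + 1, t) ∈ P.vertexSet ∧ (s, t + 1) ∈ P.vertexSet ∧
      (s + 1, t + 1) ∈ P.vertexSet := by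
  unfold Polyomino.vertexSet
  refine ⟨?_, ?_, ?_, ?_⟩ <;>
  exact Finset.mem_biUnion.2 ⟨(s, t), h, by simp [cellVertices]⟩

theorem mem_of_pair (K : Type) [Field K] (P : Polyomino) {W : Finset (ℤ × ℤ)} {x y x' y' : ℤ}
    (hx : x < x') (hy : y < y') (hb : boxIn (cellPred P) x y x' y') (h1 : (x, y') ∈ W)
    (h2 : (x', y) ∈ W) : MvPolynomial.monomial (expOf P W) (1 : K) ∈ inIdeal K P := by
  classical
  have va : (x, y) ∈ P.vertexSet := (cell_vertex (hb x y le_rfl hx le_rfl hy)).1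
  have vb : (x', y') ∈ P.vertexSet := by
    have := (cell_vertex (hb (x' - 1) (y' - 1) (by omega) (by omega) (by omega) (by omega))).2.2.2
    simpa using this
  have vc : (x, y') ∈ P.vertexSet := by
    have := (cell_vertex (hb x (y' - 1) (by omega) (by omega) (by omega) (by omega))).2.2.1
    simpa using this
  have vd : (x', y) ∈ P.vertexSet := by
    have := (cell_vertex (hb (x' - 1) y (by omega) (by omega) (by omega) (by omega))).2.1
    simpa using this
  let a : PVertex P := ⟨(x, y), va⟩
  let b : PVertex P := ⟨(x', y'), vb⟩
  let c : PVertex P := ⟨(x, y'), vc⟩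
  let d : PVertex P := ⟨(x', y), vd⟩
  have hin : IsInnerInterval P a.1 b.1 := (inner_iff P _ _).2 ⟨hx, hy, hb⟩
  have hcd : c ≠ d := fun h => by
    have := congrArg (fun v : PVertex P => v.1.1) h
    simp only [c, d] at this
    omega
  have hac : c ≠ a := fun h => by
    have := congrArg (fun v : PVertex P => v.1.2) h
    simp only [c, a] at this
    omega
  have had : d ≠ a := fun h => by
    have := congrArg (fun v : PVertex P => v.1.1) h
    simp only [a, d] at this
    omega
  have hba : b ≠ a := fun h => by
    have := congrArg (fun v : PVertex P => v.1.1) h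
    simp only [a, b] at this
    omega
  set mab : PVertex P →₀ ℕ := Finsupp.single a 1 + Finsupp.single b 1 with hmab
  set mcd : PVertex P →₀ ℕ := Finsupp.single c 1 + Finsupp.single d 1 with hmcd
  have haa : mab a = 1 := by simp [hmab, hba]
  have hca : mcd a = 0 := by simp [hmcd, hac, had]
  have hne : mab ≠ mcd := fun h => by rw [h, hca] at haa; omega
  have hf : (MvPolynomial.X a * MvPolynomial.X b - MvPolynomial.X c * MvPolynomial.X d :
      PolyRing K P) = MvPolynomial.monomial mab 1 - MvPolynomial.monomial mcd 1 := by
    simp only [MvPolynomial.X, MvPolynomial.monomial_mul, mul_one, hmab, hmcd]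
  have hfI : (MvPolynomial.monomial mab 1 - MvPolynomial.monomial mcd 1 : PolyRing K P) ∈
      polyIdeal K P := Ideal.subset_span ⟨a, b, c, d, hin, rfl, rfl, hf.symm⟩
  have hlt : pmonLT P mab mcd := by
    have hs := reach_card_lex (.single (step_of_minor hin (c := c) (d := d) rfl rfl 0))
    simp only [zero_add] at hs
    refine Or.inr ⟨?_, a, by omega, ?_⟩
    · rw [← card_ptsOf, ← card_ptsOf]
      exact hs.1.symm
    · intro w hw
      have z : ∀ v : PVertex P, v = a ∨ v = b ∨ v = c ∨ v = d → w ≠ v := by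
        rintro v h rfl
        unfold varlt at hw
        rcases h with h | h | h | h <;> simp only [h, a, b, c, d] at hw <;> omega
      have za := (z a (by simp)).symm
      have zb := (z b (by simp)).symm
      have zc := (z c (by simp)).symm
      have zd := (z d (by simp)).symm
      simp [hmab, hmcd, Finsupp.single_apply, za, zb, zc, zd]
  have hlead : IsLeadMon (pmonLT P)
      (MvPolynomial.monomial mab 1 - MvPolynomial.monomial mcd 1 : PolyRing K P) mcd := by
    constructor
    · rw [MvPolynomial.mem_support_iff, MvPolynomial.coeff_sub, MvPolynomial.coeff_monomial,
        MvPolynomial.coeff_monomial, if_neg hne, if_pos rfl]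
      simp
    · intro m' hm' hm'ne
      rw [MvPolynomial.mem_support_iff, MvPolynomial.coeff_sub, MvPolynomial.coeff_monomial,
        MvPolynomial.coeff_monomial, if_neg (Ne.symm hm'ne)] at hm'
      have : mab = m' := by
        by_contra hh
        simp [hh] at hm'
      rw [← this]
      exact hlt
  have hmem : (MvPolynomial.monomial mcd 1 : PolyRing K P) ∈ inIdeal K P := by
    refine Ideal.subset_span ⟨_, hfI, ?_, mcd, hlead, rfl⟩
    intro h0
    have := hlead.1
    rw [h0] at this
    simp at this
  have hle : mcd ≤ expOf P W := by
    intro w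
    rw [expOf_apply]
    by_cases hwc : c = w
    · subst hwc
      simp [hmcd, hcd.symm, c, h1]
    · by_cases hwd : d = w
      · subst hwd
        simp [hmcd, hcd, d, h2]
      · simp [hmcd, Finsupp.single_apply, hwc, hwd]
  have : (MvPolynomial.monomial (expOf P W) (1 : K)) =
      MvPolynomial.monomial (expOf P W - mcd) 1 * MvPolynomial.monomial mcd 1 := by
    rw [MvPolynomial.monomial_mul, tsub_add_cancel_of_le hle, mul_one]
  rw [this]
  exact Ideal.mul_mem_left _ _ hmem

theorem facet_has_free (K : Type) [Field K] (P : Polyomino) (hC : ConfHyp (cellPred P))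
    {F : Finset (ℤ × ℤ)} (hF : IsFacet K P F) {a b : ℤ} (hv : (a, b) ∈ P.vertexSet)
    (h1 : ∀ x' y, a < x' → y < b → boxIn (cellPred P) a y x' b → (x', y) ∉ F)
    (h2 : ∀ x y', x < a → b < y' → boxIn (cellPred P) x b a y' → (x, y') ∉ F) : (a, b) ∈ F := by
  classical
  have hface : IsFace K P (insert (a, b) F) := by
    refine ⟨?_, fun hmem => ?_⟩
    · rw [Finset.coe_insert]
      exact Set.insert_subset hv hF.1.1
    · obtain ⟨x, y, x', y', hx, hy, hb, m1, m2⟩ := exists_pair_of_mem K P hC hmem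
      rw [Finset.mem_insert] at m1 m2
      rcases m1 with m1 | m1
      · obtain ⟨rfl, rfl⟩ := Prod.mk.inj m1
        rcases m2 with m2 | m2
        · have := (Prod.mk.inj m2).1
          omega
        · exact h1 x' y hx hy hb m2
      · rcases m2 with m2 | m2
        · obtain ⟨rfl, rfl⟩ := Prod.mk.inj m2
          exact h2 x y' hx hy hb m1
        · exact hF.1.2 (mem_of_pair K P hx hy hb m1 m2)
  have := hF.2 _ hface (Finset.subset_insert _ _)
  rw [this]
  exact Finset.mem_insert_self _ _

theorem cell_iff {P : Polyomino} {D : FrameData} (hP : IsFrame P D) (s t : ℤ) :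
    cellPred P s t ↔ (1 ≤ s ∧ s < D.m ∧ 1 ≤ t ∧ t < D.n) ∧ (s, t) ∉ D.holeCells := by
  have : (s, t) ∈ (↑P.cells : Set (ℤ × ℤ)) ↔ (s, t) ∈ D.rectCells \ D.holeCells := by rw [hP]
  simp only [cellPred, Finset.mem_coe, Set.mem_diff, FrameData.rectCells, Set.mem_setOf_eq] at this ⊢
  rw [this]
  simp only [Int.add_one_le_iff]

theorem frame_row {P : Polyomino} {D : FrameData} (hP : IsFrame P D) (x1 y1 x2 y2 j : ℤ)
    (r1 : 1 ≤ x1 ∧ x1 < D.m ∧ 1 ≤ y1 ∧ y1 < D.n) (r2 : 1 ≤ x2 ∧ x2 < D.m ∧ 1 ≤ y2 ∧ y2 < D.n)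
    (h1 : ¬ cellPred P x1 y1) (h2 : ¬ cellPred P x2 y2) (hj2 : y2 < j) (hj1 : j ≤ y1) :
    ∃ x, min x1 x2 ≤ x ∧ x ≤ max x1 x2 ∧ ¬ cellPred P x (j - 1) ∧ ¬ cellPred P x j := by
  rw [cell_iff hP] at h1 h2
  obtain ⟨x, a, b, c, d⟩ := hole_row D (not_not.1 fun h => h1 ⟨r1, h⟩)
    (not_not.1 fun h => h2 ⟨r2, h⟩) hj2 hj1
  refine ⟨x, a, b, ?_, ?_⟩ <;> rw [cell_iff hP]
  · exact fun h => h.2 c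
  · exact fun h => h.2 d

theorem frame_col {P : Polyomino} {D : FrameData} (hP : IsFrame P D) (y1 x1 y2 x2 i : ℤ)
    (r1 : 1 ≤ y1 ∧ y1 < D.n ∧ 1 ≤ x1 ∧ x1 < D.m) (r2 : 1 ≤ y2 ∧ y2 < D.n ∧ 1 ≤ x2 ∧ x2 < D.m)
    (h1 : ¬ cellPred P x1 y1) (h2 : ¬ cellPred P x2 y2) (hj2 : x2 < i) (hj1 : i ≤ x1) :
    ∃ y, min y1 y2 ≤ y ∧ y ≤ max y1 y2 ∧ ¬ cellPred P (i - 1) y ∧ ¬ cellPred P i y := by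
  rw [cell_iff hP] at h1 h2
  obtain ⟨x, a, b, c, d⟩ := hole_col D (not_not.1 fun h => h1 ⟨by omega, h⟩)
    (not_not.1 fun h => h2 ⟨by omega, h⟩) hj2 hj1
  refine ⟨x, a, b, ?_, ?_⟩ <;> rw [cell_iff hP]
  · exact fun h => h.2 c
  · exact fun h => h.2 d

theorem boxIn_swap {C : ℤ → ℤ → Prop} {x y x' y' : ℤ}
    (h : boxIn (fun s t => C t s) x y x' y') : boxIn C y x y' x' :=
  fun s t a b c d => h t s c d a b

theorem boxIn_swap' {C : ℤ → ℤ → Prop} {x y x' y' : ℤ}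
    (h : boxIn C y x y' x') : boxIn (fun s t => C t s) x y x' y' :=
  fun s t a b c d => h t s c d a b

theorem hvert {P : Polyomino} {i k j v : ℤ} (hik : i < k)
    (hM : ∀ l, i ≤ l → l < k → hEdge P l j) (h1 : i ≤ v) (h2 : v ≤ k) :
    (v, j) ∈ P.vertexSet := by
  have aux : ∀ l, hEdge P l j → (l, j) ∈ P.vertexSet ∧ (l + 1, j) ∈ P.vertexSet := by
    rintro l (h | h)
    · exact ⟨(cell_vertex h).1, (cell_vertex h).2.1⟩
    · have := (cell_vertex h).2.2
      simpa using this
  rcases h2.lt_or_eq with h | h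
  · exact (aux v (hM v h1 h)).1
  · have := (aux (v - 1) (hM (v - 1) (by omega) (by omega))).2
    simpa using this

theorem vvert {P : Polyomino} {i k j v : ℤ} (hik : i < k)
    (hM : ∀ l, i ≤ l → l < k → vEdge P j l) (h1 : i ≤ v) (h2 : v ≤ k) :
    (j, v) ∈ P.vertexSet := by
  have aux : ∀ l, vEdge P j l → (j, l) ∈ P.vertexSet ∧ (j, l + 1) ∈ P.vertexSet := by
    rintro l (h | h)
    · exact ⟨(cell_vertex h).1, (cell_vertex h).2.2.1⟩
    · have h3 := (cell_vertex h).2.1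
      have h4 := (cell_vertex h).2.2.2
      constructor
      · simpa using h3
      · simpa using h4
  rcases h2.lt_or_eq with h | h
  · exact (aux v (hM v h1 h)).1
  · have := (aux (v - 1) (hM (v - 1) (by omega) (by omega))).2
    simpa using this

theorem frame_facet_meets_max_edge_intervals (K : Type) [Field K] (P : Polyomino)
    (D : FrameData) (hP : IsFrame P D) (F : Finset (ℤ × ℤ)) (hF : IsFacet K P F) :
    (∀ i k j : ℤ, IsMaxHEdgeInterval P i k j → ∃ v ∈ F, v.2 = j ∧ i ≤ v.1 ∧ v.1 ≤ k) ∧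
    (∀ x j l : ℤ, IsMaxVEdgeInterval P x j l → ∃ v ∈ F, v.1 = x ∧ j ≤ v.2 ∧ v.2 ≤ l) := by
  have hrect : ∀ s t, cellPred P s t → 1 ≤ s ∧ s < D.m ∧ 1 ≤ t ∧ t < D.n :=
    fun s t h => ((cell_iff hP s t).1 h).1
  have hC : ConfHyp (cellPred P) := conf_of_row hrect (frame_row hP)
  constructor
  · rintro i k j ⟨hik, hM, hi, hk⟩
    obtain ⟨v, hv1, hv2, h1, h2⟩ := exists_free_point hrect (frame_row hP)
      (G := fun s t => (s, t) ∈ F)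
      (fun x y x' y' hx hy hb m1 m2 => hF.1.2 (mem_of_pair K P hx hy hb m1 m2)) hik hM hi hk
    exact ⟨(v, j), facet_has_free K P hC hF (hvert hik hM hv1 hv2) h1 h2, rfl, hv1, hv2⟩
  · rintro j i k ⟨hik, hM, hi, hk⟩
    obtain ⟨v, hv1, hv2, h1, h2⟩ := exists_free_point (C := fun s t => cellPred P t s)
      (fun s t h => by have := hrect t s h; omega) (frame_col hP)
      (G := fun s t => (t, s) ∈ F)
      (fun x y x' y' hx hy hb m1 m2 =>
        hF.1.2 (mem_of_pair K P hy hx (boxIn_swap hb) m2 m1)) hik hM hi hk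
    exact ⟨(j, v), facet_has_free K P hC hF (vvert hik hM hv1 hv2)
      (fun x' y a b c => h2 y x' b a (boxIn_swap' c))
      (fun x y' a b c => h1 y' x b a (boxIn_swap' c)), rfl, hv1, hv2⟩
end
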